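/- Let K be a cubic field with resolvent discriminant d, and let e be the number of distinct odd primes p that are totally ramified in K and satisfy (d/p) = 1, where (·/p) is the Legendre symbol. Then: if e ≥ 1, then 3^{e−1} divides h(K); and if moreover K/ℚ is not Galois (equivalently, Δ_K is not a perfect square), then 3^e divides h(K). -/

import Mathlib

open NumberField IntermediateField Polynomial

noncomputable section

/-- The set of cubic subfields of `ℂ` whose discriminant satisfies `P`. -/
def CubicSet (P : ℤ → Prop) : Set (IntermediateField ℚ ℂ) :=
  {F | ∃ h : Module.finrank ℚ F = 3,
    letI : FiniteDimensional ℚ F := FiniteDimensional.of_finrank_eq_succ h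
    letI : NumberField F := ⟨⟩
    P (NumberField.discr F)}

/-- Cubic subfields of `ℂ`, up to `ℚ`-algebra isomorphism.  Since every cubic field
embeds into `ℂ`, these classes are exactly the isomorphism classes of cubic fields. -/
def cubicSetoid (P : ℤ → Prop) : Setoid (CubicSet P) where
  r F G := Nonempty (F.1 ≃ₐ[ℚ] G.1)
  iseqv := ⟨fun _ => ⟨AlgEquiv.refl⟩, fun ⟨e⟩ => ⟨e.symm⟩, fun ⟨e⟩ ⟨f⟩ => ⟨e.trans f⟩⟩

/-- The number of isomorphism classes of cubic fields whose discriminant satisfies `P`. -/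
def cubicCount (P : ℤ → Prop) : ℕ := Nat.card (Quotient (cubicSetoid P))

/-- A prime `p` is totally ramified in `K` if `pO_K = 𝔭³` for a prime ideal `𝔭`. -/
def TotallyRamified (p : ℕ) (K : Type*) [Field K] [NumberField K] : Prop :=
  ∃ 𝔭 : Ideal (𝓞 K), 𝔭.IsPrime ∧ Ideal.span {(p : 𝓞 K)} = 𝔭 ^ 3

lemma isIntegral_of_sq (Δ : ℤ) (x : ℂ) (hx : x ^ 2 = (Δ : ℂ)) : IsIntegral ℚ x := by
  refine ⟨X ^ 2 - C (Δ : ℚ), monic_X_pow_sub_C _ two_ne_zero, ?_⟩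
  simp only [eval₂_sub, eval₂_X_pow, eval₂_C, hx]
  simp [map_intCast]

/-- `d` is the resolvent discriminant of a cubic field of discriminant `Δ`:
`d = 1` if `Δ` is a perfect square, and otherwise `d` is the discriminant of the
quadratic field `ℚ(√Δ)` (which does not depend on the chosen square root `x` of `Δ`). -/
def IsResolventDiscrOf (Δ d : ℤ) : Prop :=
  (IsSquare Δ ∧ d = 1) ∨
  (¬ IsSquare Δ ∧ ∃ (x : ℂ) (hx : x ^ 2 = (Δ : ℂ)),
    letI : FiniteDimensional ℚ ℚ⟮x⟯ := adjoin.finiteDimensional (isIntegral_of_sq Δ x hx)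
    letI : NumberField ℚ⟮x⟯ := ⟨⟩
    d = NumberField.discr ℚ⟮x⟯)

/-- The discriminant of the cubic polynomial `X^3 + a X^2 + b X + c`. -/
def cubicD (a b c : ℤ) : ℤ :=
  a ^ 2 * b ^ 2 - 4 * b ^ 3 - 4 * a ^ 3 * c - 27 * c ^ 2 + 18 * a * b * c

/-- The sum of the principal 2-by-2 minors of a 3-by-3 matrix. -/
def cubicE2 (M : Matrix (Fin 3) (Fin 3) ℤ) : ℤ :=
  M 0 0 * M 1 1 - M 0 1 * M 1 0 + M 0 0 * M 2 2 - M 0 2 * M 2 0 +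
    M 1 1 * M 2 2 - M 1 2 * M 2 1

set_option maxHeartbeats 1000000 in
lemma cubic_matrix_CH (M : Matrix (Fin 3) (Fin 3) ℤ) :
    M ^ 3 + (-M.trace) • M ^ 2 + cubicE2 M • M + (-M.det) • 1 = 0 := by
  have h2 : ∀ i j, (M ^ 2) i j = M i 0 * M 0 j + M i 1 * M 1 j + M i 2 * M 2 j := by
    intro i j; rw [pow_two, Matrix.mul_apply, Fin.sum_univ_three]
  have h3 : ∀ i j, (M ^ 3) i j =
      (M ^ 2) i 0 * M 0 j + (M ^ 2) i 1 * M 1 j + (M ^ 2) i 2 * M 2 j := by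
    intro i j; rw [pow_succ, Matrix.mul_apply, Fin.sum_univ_three]
  rw [Matrix.det_fin_three, Matrix.trace_fin_three]
  ext i j
  simp only [Matrix.add_apply, Matrix.smul_apply, h3, h2, smul_eq_mul, Matrix.zero_apply, cubicE2]
  fin_cases i <;> fin_cases j <;> simp <;> ring

lemma cubic_matrix (M : Matrix (Fin 3) (Fin 3) ℤ) : ∃ a b c : ℤ,
    M ^ 3 + a • M ^ 2 + b • M + c • 1 = 0 ∧
    (∀ n t : ℤ, (n • M + t • 1).det = t ^ 3 - a * n * t ^ 2 + b * n ^ 2 * t - c * n ^ 3) ∧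
    (Matrix.of fun i j : Fin 3 => (M ^ (i.val + j.val)).trace).det = cubicD a b c := by
  have hM : ∀ a b c : ℤ, M ^ 3 + a • M ^ 2 + b • M + c • 1 = 0 → M.trace = -a →
      (M ^ 2).trace = a ^ 2 - 2 * b →
      (Matrix.of fun i j : Fin 3 => (M ^ (i.val + j.val)).trace).det = cubicD a b c := by
    intro a b c h h1 h2
    have h3 : (M ^ 3).trace = - a * (a ^ 2 - 2 * b) - b * (-a) - 3 * c := by
      have := congrArg Matrix.trace h
      simp only [Matrix.trace_add, Matrix.trace_smul, h1, h2, Matrix.trace_one, Matrix.trace_zero,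
        smul_eq_mul, Fintype.card_fin] at this
      push_cast at this
      linarith
    have h4 : (M ^ 4).trace = - a * (M ^ 3).trace - b * (a ^ 2 - 2 * b) - c * (-a) := by
      have := congrArg (fun N => Matrix.trace (N * M)) h
      simp only [add_mul, Matrix.smul_mul, ← pow_succ, one_mul, ← pow_two, Matrix.trace_add,
        Matrix.trace_smul, h1, h2, Matrix.trace_zero, zero_mul,
        smul_eq_mul] at this
      norm_num at this
      linarith
    rw [Matrix.det_fin_three]
    simp [Matrix.of_apply, h1, h2, h3, h4, cubicD]
    ring
  have hCH : M ^ 3 + (-M.trace) • M ^ 2 + cubicE2 M • M + (-M.det) • 1 = 0 :=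
    cubic_matrix_CH M
  refine ⟨-M.trace, cubicE2 M, -M.det, hCH, ?_, hM _ _ _ hCH (by simp) ?_⟩
  · intro n t
    simp only [Matrix.trace_fin_three, Matrix.det_fin_three, cubicE2, Matrix.add_apply,
      Matrix.smul_apply, smul_eq_mul]
    simp
    ring
  · simp [pow_two, Matrix.mul_apply, Fin.sum_univ_three, Matrix.trace_fin_three, cubicE2]
    ring

section
variable {K : Type*} [Field K] [NumberField K]

lemma exists_basis3 (hK : Module.finrank ℚ K = 3) : Nonempty (Module.Basis (Fin 3) ℤ (𝓞 K)) := by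
  have : Module.finrank ℤ (𝓞 K) = 3 := by rw [RingOfIntegers.rank, hK]
  exact ⟨(Module.finBasisOfFinrankEq ℤ (𝓞 K) this)⟩

lemma cubic_data (hK : Module.finrank ℚ K = 3) (θ : 𝓞 K) : ∃ a b c s : ℤ,
    θ ^ 3 + a * θ ^ 2 + b * θ + c = 0 ∧
    (∀ n t : ℤ, Algebra.norm ℤ ((n : 𝓞 K) * θ + t) =
      t ^ 3 - a * n * t ^ 2 + b * n ^ 2 * t - c * n ^ 3) ∧
    cubicD a b c = NumberField.discr K * s ^ 2 ∧
    (s = 0 → ∃ x y z : ℤ, (x ≠ 0 ∨ y ≠ 0 ∨ z ≠ 0) ∧ (x : 𝓞 K) + y * θ + z * θ ^ 2 = 0) := by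
  classical
  obtain ⟨B⟩ := exists_basis3 hK
  obtain ⟨a, b, c, h1, h2, h3⟩ := cubic_matrix (Algebra.leftMulMatrix B θ)
  let v : Fin 3 → 𝓞 K := fun i => θ ^ i.val
  refine ⟨a, b, c, (B.toMatrix v).det, ?_, ?_, ?_, ?_⟩
  · apply Algebra.leftMulMatrix_injective B
    simp only [map_add, map_mul, map_pow, map_zero]
    rw [← h1]
    simp only [map_intCast, zsmul_eq_mul, mul_one]
  · intro n t
    rw [← h2, Algebra.norm_eq_matrix_det B]
    simp only [map_add, map_mul, map_intCast, zsmul_eq_mul, mul_one]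
  · rw [← h3, ← NumberField.discr_eq_discr K B, mul_comm, ← Algebra.discr_of_matrix_vecMul,
      Module.Basis.toMatrix_map_vecMul, Algebra.discr_def]
    congr 1
    ext i j
    rw [Algebra.traceMatrix_apply, Algebra.traceForm_apply, Algebra.trace_eq_matrix_trace B]
    simp only [v, ← pow_add, map_pow, Matrix.of_apply]
  · intro hs
    obtain ⟨w, hw0, hw⟩ := Matrix.exists_mulVec_eq_zero_iff.mpr hs
    refine ⟨w 0, w 1, w 2, ?_, ?_⟩
    · by_contra! h
      apply hw0
      ext i
      fin_cases i <;> simp [h]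
    · have : (∑ i, w i • v i) = 0 := by
        apply B.repr.injective
        ext i
        have := congrFun hw i
        simp only [Matrix.mulVec, dotProduct, Module.Basis.toMatrix_apply, Pi.zero_apply] at this
        simp only [map_sum, map_smul, Finsupp.coe_finsetSum, Finset.sum_apply, Finsupp.smul_apply,
          smul_eq_mul, map_zero, Finsupp.zero_apply]
        rw [← this]
        exact Finset.sum_congr rfl fun _ _ => mul_comm _ _
      simpa [Fin.sum_univ_three, v] using this
end


lemma finrank_quadratic (Δ : ℤ) (hΔ : ¬ IsSquare Δ) (x : ℂ) (hx : x ^ 2 = (Δ : ℂ)) :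
    Module.finrank ℚ ℚ⟮x⟯ = 2 := by
  rw [IntermediateField.adjoin.finrank (isIntegral_of_sq Δ x hx)]
  have hirr : Irreducible (X ^ 2 - C (Δ : ℚ)) := by
    apply X_pow_sub_C_irreducible_of_prime Nat.prime_two
    intro b hb
    apply hΔ
    rw [← Rat.isSquare_intCast_iff]
    exact ⟨b, by rw [← hb, pow_two]⟩
  rw [← minpoly.eq_of_irreducible_of_monic hirr (by simp [hx]) (monic_X_pow_sub_C _ two_ne_zero)]
  exact natDegree_X_pow_sub_C

lemma quad_trace (M : Matrix (Fin 2) (Fin 2) ℤ) (Δ : ℤ) (hΔ : ¬ IsSquare Δ)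
    (h : M * M = Δ • 1) : M.trace = 0 := by
  by_contra hne
  rw [Matrix.trace_fin_two] at hne
  have h00 := congrFun (congrFun h 0) 0
  have h01 := congrFun (congrFun h 0) 1
  simp only [Matrix.mul_apply, Fin.sum_univ_two, Matrix.smul_apply, smul_eq_mul] at h00 h01
  simp at h00 h01
  have h2 : M 0 1 = 0 := by
    have : (M 0 0 + M 1 1) * M 0 1 = 0 := by linarith
    exact (mul_eq_zero.mp this).resolve_left hne
  rw [h2] at h00
  exact hΔ ⟨M 0 0, by linarith⟩

lemma quad_discr (F : Type*) [Field F] [NumberField F] (hF : Module.finrank ℚ F = 2) (Δ : ℤ)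
    (hΔ : ¬ IsSquare Δ) (x : F) (hx : x ^ 2 = (Δ : F)) :
    ∃ s : ℤ, 4 * Δ = NumberField.discr F * s ^ 2 := by
  classical
  have hfr : Module.finrank ℤ (𝓞 F) = 2 := by rw [RingOfIntegers.rank, hF]
  let B := Module.finBasisOfFinrankEq ℤ (𝓞 F) hfr
  have hxi : IsIntegral ℤ x := by
    refine ⟨X ^ 2 - C Δ, monic_X_pow_sub_C _ two_ne_zero, ?_⟩
    simp only [eval₂_sub, eval₂_X_pow, eval₂_C, hx]
    simp
  obtain ⟨θ, rfl⟩ : ∃ θ : 𝓞 F, (θ : F) = x := ⟨⟨x, hxi⟩, rfl⟩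
  have hθ : θ ^ 2 = (Δ : 𝓞 F) := by
    apply RingOfIntegers.coe_injective
    rw [map_pow, hx]; simp
  have htr : Algebra.trace ℤ (𝓞 F) θ = 0 := by
    rw [Algebra.trace_eq_matrix_trace B]
    apply quad_trace _ Δ hΔ
    rw [← map_mul, ← pow_two, hθ, map_intCast, zsmul_eq_mul, mul_one]
  let v : Fin 2 → 𝓞 F := ![1, θ]
  refine ⟨(B.toMatrix v).det, ?_⟩
  rw [← NumberField.discr_eq_discr F B, mul_comm _ (_ ^ 2), ← Algebra.discr_of_matrix_vecMul,
      Module.Basis.toMatrix_map_vecMul, Algebra.discr_def, Matrix.det_fin_two]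
  have h1 : Algebra.trace ℤ (𝓞 F) 1 = 2 := by
    have := Algebra.trace_algebraMap_of_basis B 1
    simpa using this
  have h2 : Algebra.trace ℤ (𝓞 F) (θ * θ) = 2 * Δ := by
    have := Algebra.trace_algebraMap_of_basis B Δ
    rw [← pow_two, hθ]
    simpa using this
  simp [Algebra.traceMatrix_apply, Algebra.traceForm_apply, v, h1, h2, htr]
  ring

lemma resolvent_rel {Δ d : ℤ} (h0 : Δ ≠ 0) (hd : IsResolventDiscrOf Δ d) :
    ∃ u v : ℤ, u ≠ 0 ∧ v ≠ 0 ∧ d * u ^ 2 = Δ * v ^ 2 := by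
  rcases hd with ⟨⟨r, hr⟩, rfl⟩ | ⟨hns, x, hx, hd⟩
  · refine ⟨r, 1, ?_, one_ne_zero, by rw [hr]; ring⟩
    rintro rfl
    simp at hr; exact h0 hr
  · have : FiniteDimensional ℚ ℚ⟮x⟯ := adjoin.finiteDimensional (isIntegral_of_sq Δ x hx)
    have : NumberField ℚ⟮x⟯ := ⟨⟩
    obtain ⟨s, hs⟩ := quad_discr ℚ⟮x⟯ (finrank_quadratic Δ hns x hx) Δ hns
      (IntermediateField.AdjoinSimple.gen ℚ x) (by
        apply Subtype.ext
        simp [hx])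
    refine ⟨s, 2, ?_, two_ne_zero, ?_⟩
    · rintro rfl
      simp at hs; exact h0 hs
    · have hd' : d = NumberField.discr ℚ⟮x⟯ := hd
      rw [hd', ← hs]; ring

lemma int_isSquare_of_mul_sq {x y u v : ℤ} (hu : u ≠ 0) (h : x * u ^ 2 = y * v ^ 2)
    (hy : IsSquare y) : IsSquare x := by
  obtain ⟨r, rfl⟩ := hy
  rw [← Rat.isSquare_intCast_iff]
  refine ⟨r * v / u, ?_⟩
  have hu' : (u : ℚ) ≠ 0 := by exact_mod_cast hu
  have : (x : ℚ) * u ^ 2 = r * r * v ^ 2 := by exact_mod_cast h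
  field_simp
  linarith

lemma resolvent_nonsquare {Δ d : ℤ} (h0 : Δ ≠ 0) (hd : IsResolventDiscrOf Δ d)
    (hΔ : ¬ IsSquare Δ) : ¬ IsSquare d := by
  obtain ⟨u, v, hu, hv, h⟩ := resolvent_rel h0 hd
  exact fun hsq => hΔ (int_isSquare_of_mul_sq hv h.symm hsq)



section
variable {K : Type*} [Field K] [NumberField K]

lemma exists_primitive (K : Type*) [Field K] [NumberField K] : ∃ θ : 𝓞 K, ℚ⟮(θ : K)⟯ = ⊤ := by
  obtain ⟨α, hα⟩ := Field.exists_primitive_element ℚ K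
  obtain ⟨y, hy0, hy⟩ := ((IsFractionRing.isAlgebraic_iff ℤ ℚ K).mpr
    (Algebra.IsAlgebraic.isAlgebraic α)).exists_integral_multiple
  refine ⟨⟨y • α, hy⟩, ?_⟩
  rw [eq_top_iff, ← hα, IntermediateField.adjoin_simple_le_iff]
  have h1 : (y • α : K) ∈ ℚ⟮(y • α : K)⟯ := IntermediateField.mem_adjoin_simple_self ℚ _
  have h2 : ((y : ℚ)⁻¹ • (y • α : K)) ∈ ℚ⟮(y • α : K)⟯ := IntermediateField.smul_mem _ h1
  have hy' : (y : ℚ) ≠ 0 := by exact_mod_cast hy0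
  have h3 : ((y : ℚ)⁻¹ • (y • α : K)) = α := by
    rw [← Int.cast_smul_eq_zsmul ℚ, inv_smul_smul₀ hy']
  rw [h3] at h2
  exact h2

lemma primitive_data (hK : Module.finrank ℚ K = 3) : ∃ (θ : 𝓞 K) (a b c s : ℤ),
    ℚ⟮(θ : K)⟯ = ⊤ ∧ θ ^ 3 + a * θ ^ 2 + b * θ + c = 0 ∧
    (∀ η : 𝓞 K, ∀ q t : ℤ, θ = t + q * η → q ∣ cubicD a b c) ∧
    cubicD a b c = NumberField.discr K * s ^ 2 ∧ s ≠ 0 := by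
  obtain ⟨θ, hθ⟩ := exists_primitive K
  obtain ⟨a, b, c, s, h1, h2, h3, h4⟩ := cubic_data hK θ
  refine ⟨θ, a, b, c, s, hθ, h1, ?_, h3, ?_⟩
  · intro η q t h
    obtain ⟨a', b', c', -, -, h2', -, -⟩ := cubic_data hK η
    have key : ∀ m : ℤ, m ^ 3 - a * m ^ 2 + b * m - c =
        (t + m) ^ 3 - a' * q * (t + m) ^ 2 + b' * q ^ 2 * (t + m) - c' * q ^ 3 := by
      intro m
      rw [← h2' q (t + m)]
      have := h2 1 m
      simp only [Int.cast_one, one_mul, mul_one, one_pow] at this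
      rw [← this, h]
      congr 1
      push_cast
      ring
    have k0 := key 0
    have k1 := key 1
    have k2 := key (-1)
    have ea : a = a' * q - 3 * t := by linarith
    have eb : b = 3 * t ^ 2 - 2 * a' * q * t + b' * q ^ 2 := by linarith
    have ec : c = - (t ^ 3 - a' * q * t ^ 2 + b' * q ^ 2 * t - c' * q ^ 3) := by linarith
    refine ⟨q ^ 5 * cubicD a' b' c', ?_⟩
    rw [ea, eb, ec]
    unfold cubicD
    ring
  · intro hs
    obtain ⟨x, y, z, hxyz, h0⟩ := h4 hs
    let p : ℚ[X] := C (x : ℚ) + C (y : ℚ) * X + C (z : ℚ) * X ^ 2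
    have hp : p ≠ 0 := by
      intro hp
      have c0 := congrArg (fun r => coeff r 0) hp
      have c1 := congrArg (fun r => coeff r 1) hp
      have c2 := congrArg (fun r => coeff r 2) hp
      simp [p, coeff_X, coeff_C, -eq_intCast, -map_intCast] at c0 c1 c2
      rcases hxyz with h | h | h <;> contradiction
    have hdeg : p.natDegree ≤ 2 := by
      simp only [p]
      compute_degree
    have hev : aeval (θ : K) p = 0 := by
      have := congrArg (fun r : 𝓞 K => (r : K)) h0
      simp only [map_add, map_mul, map_pow, map_intCast, map_zero] at this
      simp only [p, map_add, map_mul, map_pow, aeval_X, aeval_C]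
      simpa using this
    have h5 : (minpoly ℚ (θ : K)).natDegree = 3 := by
      rw [← hK, ← IntermediateField.finrank_top' (F := ℚ) (E := K), ← hθ,
        IntermediateField.adjoin.finrank (Algebra.IsIntegral.isIntegral _)]
    have := natDegree_le_natDegree (minpoly.degree_le_of_ne_zero ℚ (θ : K) hp hev)
    omega

lemma isGalois_of_isSquare (hK : Module.finrank ℚ K = 3) (h : IsSquare (NumberField.discr K)) :
    IsGalois ℚ K := by
  obtain ⟨θ, a, b, c, s, htop, h1, -, hD, hs⟩ := primitive_data hK
  obtain ⟨r, hr⟩ := h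
  have hD0 : cubicD a b c ≠ 0 := by
    rw [hD]; exact mul_ne_zero (NumberField.discr_ne_zero K) (pow_ne_zero 2 hs)
  obtain ⟨δ, hδ⟩ : ∃ δ : ℤ, cubicD a b c = δ ^ 2 := ⟨r * s, by rw [hD, hr]; ring⟩
  set x : K := (θ : K) with hx
  have hf : x ^ 3 + a * x ^ 2 + b * x + c = 0 := by
    have := congrArg (fun r : 𝓞 K => (r : K)) h1
    simpa only [map_add, map_mul, map_pow, map_intCast, map_zero] using this
  have hDK : (a : K) ^ 2 * b ^ 2 - 4 * b ^ 3 - 4 * a ^ 3 * c - 27 * c ^ 2 + 18 * a * b * c = δ ^ 2 := by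
    have := congrArg (fun r : ℤ => (r : K)) hδ
    simpa [cubicD] using this
  have hδ0 : (δ : K) ≠ 0 := by
    rw [Int.cast_ne_zero]
    rintro rfl
    exact hD0 (by rw [hδ]; ring)
  have hE : ((a + x) ^ 2 - 4 * (b + a * x + x ^ 2)) * (3 * x ^ 2 + 2 * a * x + b) ^ 2 = δ ^ 2 := by
    rw [← hDK]
    have hc : (c : K) = -(x ^ 3 + a * x ^ 2 + b * x) := by linear_combination hf
    rw [hc]; ring
  have hf' : (3 * x ^ 2 + 2 * a * x + b) ≠ 0 := by
    intro h0
    rw [h0] at hE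
    apply hδ0
    have : (δ : K) ^ 2 = 0 := by rw [← hE]; ring
    exact pow_eq_zero_iff (two_ne_zero) |>.mp this
  obtain ⟨w, hw⟩ : ∃ w : K, w ^ 2 = (a + x) ^ 2 - 4 * (b + a * x + x ^ 2) := by
    refine ⟨δ / (3 * x ^ 2 + 2 * a * x + b), ?_⟩
    rw [div_pow, ← hE, mul_div_assoc, div_self (pow_ne_zero 2 hf'), mul_one]
  let f : ℚ[X] := X ^ 3 + C (a : ℚ) * X ^ 2 + C (b : ℚ) * X + C (c : ℚ)
  have hfm : f.map (algebraMap ℚ K) =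
      (X - C x) * ((X - C ((-(a + x) + w) / 2)) * (X - C ((-(a + x) - w) / 2))) := by
    have e1 : ((-(a + x) + w) / 2) + ((-(a + x) - w) / 2) = -(a + x) := by ring
    have e2 : ((-(a + x) + w) / 2) * ((-(a + x) - w) / 2) = b + a * x + x ^ 2 := by
      linear_combination (-1 / 4 : K) * hw
    have e3 : (X - C ((-(a + x) + w) / 2)) * (X - C ((-(a + x) - w) / 2)) =
        X ^ 2 + C (a + x) * X + C (b + a * x + x ^ 2) := by
      rw [← e2, C_mul]
      have : C (a + x) = - (C ((-(a + x) + w) / 2) + C ((-(a + x) - w) / 2)) := by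
        rw [← C_add, e1, ← C_neg, neg_neg]
      rw [this]; ring
    rw [e3]
    have hc : (C (c : K)) = -((C x) ^ 3 + C (a : K) * (C x) ^ 2 + C (b : K) * C x) := by
      rw [← C_pow, ← C_pow, ← C_mul, ← C_mul, ← C_add, ← C_add, ← C_neg]
      congr 1
      linear_combination hf
    simp only [f, Polynomial.map_add, Polynomial.map_mul, Polynomial.map_pow, map_X, map_C]
    rw [show (algebraMap ℚ K) (c : ℚ) = (c : K) by simp, show (algebraMap ℚ K) (b : ℚ) = (b : K) by simp,
      show (algebraMap ℚ K) (a : ℚ) = (a : K) by simp, hc]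
    simp only [C_add, C_mul, C_pow]
    ring
  have hspl : IsSplittingField ℚ K f := by
    refine ⟨?_, ?_⟩
    · rw [hfm]
      exact (Splits.X_sub_C _).mul ((Splits.X_sub_C _).mul (Splits.X_sub_C _))
    · rw [eq_top_iff]
      have h2 : Algebra.adjoin ℚ {x} = ⊤ := by
        rw [← IntermediateField.adjoin_simple_toSubalgebra_of_isAlgebraic
          (Algebra.IsAlgebraic.isAlgebraic x), htop]
        rfl
      rw [← h2]
      apply Algebra.adjoin_mono
      rw [Set.singleton_subset_iff, mem_rootSet]
      refine ⟨?_, ?_⟩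
      · intro h0
        have := congrArg (fun r => coeff r 3) h0
        simp [f, -eq_intCast, -map_intCast] at this
      · rw [aeval_def, ← eval_map, hfm]; simp
  have : Normal ℚ K := Normal.of_isSplittingField f
  exact ⟨⟩
end


lemma coprime_rel {E d x y : ℤ} (hx : x ≠ 0) (h : E * x ^ 2 = d * y ^ 2) :
    ∃ x' y' : ℤ, IsCoprime x' y' ∧ E * x' ^ 2 = d * y' ^ 2 := by
  obtain ⟨x', hx'⟩ := Int.gcd_dvd_left (a := x) (b := y)
  obtain ⟨y', hy'⟩ := Int.gcd_dvd_right (a := x) (b := y)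
  have hg : (Int.gcd x y : ℤ) ≠ 0 := by
    intro h0
    rw [h0, zero_mul] at hx'
    exact hx hx'
  refine ⟨x', y', ?_, ?_⟩
  · have hb := Int.gcd_eq_gcd_ab x y
    refine ⟨Int.gcdA x y, Int.gcdB x y, mul_left_cancel₀ hg ?_⟩
    set g : ℤ := (Int.gcd x y : ℤ)
    rw [mul_one]
    linear_combination -hb - (Int.gcdA x y) * hx' - (Int.gcdB x y) * hy'
  · apply mul_left_cancel₀ (pow_ne_zero 2 hg)
    set g : ℤ := (Int.gcd x y : ℤ)
    rw [hx', hy'] at h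
    linear_combination h

lemma no_odd_val {p E d x y : ℤ} (hp : Prime p) (hd : ¬ p ∣ d) (hE : ¬ p ∣ E) (hx : x ≠ 0)
    (h : (p * E) * x ^ 2 = d * y ^ 2) : False := by
  obtain ⟨x, y, hc, h⟩ := coprime_rel hx h
  have hy : p ∣ y := by
    have : p ∣ d * y ^ 2 := ⟨E * x ^ 2, by rw [← h]; ring⟩
    exact hp.dvd_of_dvd_pow ((hp.dvd_or_dvd this).resolve_left hd)
  have hx : p ∣ x := by
    obtain ⟨z, rfl⟩ := hy
    have : p * (E * x ^ 2) = p * (p * (d * z ^ 2)) := by linear_combination h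
    have := mul_left_cancel₀ hp.ne_zero this
    have : p ∣ E * x ^ 2 := ⟨_, this⟩
    exact hp.dvd_of_dvd_pow ((hp.dvd_or_dvd this).resolve_left hE)
  exact hp.not_isUnit (hc.isUnit_of_dvd' hx hy)

lemma unit_rel {p E d x y : ℤ} (hp : Prime p) (hd : ¬ p ∣ d) (hE : ¬ p ∣ E) (hx : x ≠ 0)
    (h : E * x ^ 2 = d * y ^ 2) : ∃ x' y' : ℤ, ¬ p ∣ x' ∧ ¬ p ∣ y' ∧ E * x' ^ 2 = d * y' ^ 2 := by
  obtain ⟨x, y, hc, h⟩ := coprime_rel hx h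
  have hxy : p ∣ x → p ∣ y := by
    rintro ⟨z, rfl⟩
    have : p ∣ d * y ^ 2 := ⟨E * p * z ^ 2, by rw [← h]; ring⟩
    exact hp.dvd_of_dvd_pow ((hp.dvd_or_dvd this).resolve_left hd)
  have hyx : p ∣ y → p ∣ x := by
    rintro ⟨z, rfl⟩
    have : p ∣ E * x ^ 2 := ⟨d * p * z ^ 2, by rw [h]; ring⟩
    exact hp.dvd_of_dvd_pow ((hp.dvd_or_dvd this).resolve_left hE)
  have hnx : ¬ p ∣ x := fun hx => hp.not_isUnit (hc.isUnit_of_dvd' hx (hxy hx))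
  exact ⟨x, y, hnx, fun hy => hnx (hyx hy), h⟩

lemma three_arith {a b c d x y : ℤ} (hd : d % 3 = 1) (hx : x ≠ 0)
    (ha : 3 ∣ a) (hb : 3 ∣ b) (hc : 3 ∣ c) (hc9 : ¬ 9 ∣ c)
    (h : cubicD a b c * x ^ 2 = d * y ^ 2) : 9 ∣ b ∧ 9 ∣ a + c := by
  have hd3 : ¬ (3 : ℤ) ∣ d := by omega
  obtain ⟨a, rfl⟩ := ha
  obtain ⟨b, rfl⟩ := hb
  obtain ⟨c, rfl⟩ := hc
  have hc3 : ¬ (3 : ℤ) ∣ c := by omega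
  have h3b : (3 : ℤ) ∣ b := by
    by_contra hb
    refine no_odd_val (p := 3) (E := 3 * a ^ 2 * b ^ 2 - 4 * b ^ 3 - 12 * a ^ 3 * c - 9 * c ^ 2
      + 18 * a * b * c) (x := 3 * x) (y := y) (d := d) Int.prime_three hd3 ?_ (by simpa using hx) ?_
    · intro hdvd
      have : (3 : ℤ) ∣ b ^ 3 := by
        have e : b ^ 3 = 3 * (a ^ 2 * b ^ 2 - b ^ 3 - 4 * a ^ 3 * c - 3 * c ^ 2 + 6 * a * b * c) -
          (3 * a ^ 2 * b ^ 2 - 4 * b ^ 3 - 12 * a ^ 3 * c - 9 * c ^ 2 + 18 * a * b * c) := by ring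
        rw [e]
        exact dvd_sub (dvd_mul_right _ _) hdvd
      exact hb (Int.prime_three.dvd_of_dvd_pow this)
    · rw [← h]; unfold cubicD; ring
  obtain ⟨b, rfl⟩ := h3b
  have h3a : ¬ (3 : ℤ) ∣ a := by
    rintro ⟨a, rfl⟩
    refine no_odd_val (p := 3) (E := - c ^ 2 +
      3 * (9 * a ^ 2 * b ^ 2 - 4 * b ^ 3 - 12 * a ^ 3 * c + 6 * a * b * c))
      (x := 9 * x) (y := y) (d := d) Int.prime_three hd3 ?_ (by simpa using hx) ?_
    · intro hdvd
      have : (3 : ℤ) ∣ c ^ 2 := by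
        obtain ⟨z, hz⟩ := hdvd
        exact ⟨(9 * a ^ 2 * b ^ 2 - 4 * b ^ 3 - 12 * a ^ 3 * c + 6 * a * b * c) - z,
          by linear_combination -hz⟩
      exact hc3 (Int.prime_three.dvd_of_dvd_pow this)
    · rw [← h]; unfold cubicD; ring
  refine ⟨⟨b, by ring⟩, ?_⟩
  have ⟨k, hk⟩ : ∃ k : ℤ, cubicD (3 * a) (3 * (3 * b)) (3 * c) = 81 * (- (a ^ 3 * c) + 3 * k) :=
    ⟨3 * a ^ 2 * b ^ 2 - 12 * b ^ 3 - a ^ 3 * c - c ^ 2 + 6 * a * b * c,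
      by unfold cubicD; ring⟩
  rw [hk] at h
  have hac : ¬ (3 : ℤ) ∣ (- (a ^ 3 * c) + 3 * k) := by
    intro hdvd
    have : (3 : ℤ) ∣ a ^ 3 * c := by
      obtain ⟨z, hz⟩ := hdvd
      exact ⟨k - z, by linear_combination -hz⟩
    rcases Int.prime_three.dvd_or_dvd this with h | h
    · exact h3a (Int.prime_three.dvd_of_dvd_pow h)
    · exact hc3 h
  obtain ⟨x', y', hx', hy', h'⟩ := unit_rel (p := 3) (E := - (a ^ 3 * c) + 3 * k) (x := 9 * x) (y := y)
    Int.prime_three hd3 hac (by simpa using hx) (by rw [← h]; ring)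
  have e1 : a * a % 3 = 1 := by
    have : a % 3 = 1 ∨ a % 3 = 2 := by omega
    rcases this with h | h <;> simp [Int.mul_emod, h]
  have e2 : x' ^ 2 % 3 = 1 := by
    have : x' % 3 = 1 ∨ x' % 3 = 2 := by omega
    rcases this with h | h <;> simp [pow_two, Int.mul_emod, h]
  have e3 : y' ^ 2 % 3 = 1 := by
    have : y' % 3 = 1 ∨ y' % 3 = 2 := by omega
    rcases this with h | h <;> simp [pow_two, Int.mul_emod, h]
  have e4 : (- (a ^ 3 * c) + 3 * k) % 3 = 1 := by
    have l1 : ((- (a ^ 3 * c) + 3 * k) * x' ^ 2) % 3 = (- (a ^ 3 * c) + 3 * k) % 3 := by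
      rw [Int.mul_emod, e2]; simp
    rw [← l1, h', Int.mul_emod, e3, hd]; rfl
  have e5 : (a * c) % 3 = 2 := by
    have : (a ^ 3 * c) % 3 = (a * c) % 3 := by
      have : a ^ 3 * c = (a * a) * (a * c) := by ring
      rw [this, Int.mul_emod, e1]; simp
    omega
  have h3 : (a + c) % 3 = 0 := by
    have ha : a % 3 = 1 ∨ a % 3 = 2 := by omega
    have hc : c % 3 = 1 ∨ c % 3 = 2 := by omega
    rw [Int.mul_emod] at e5
    rcases ha with ha | ha <;> rcases hc with hc | hc <;> rw [ha, hc] at e5 <;> omega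
  omega

/-- The relation between `d` and the residue of `p` modulo 3. -/
lemma three_dvd_sub_one {p : ℕ} [Fact p.Prime] (hp3 : p ≠ 3) (hp2 : p ≠ 2) {a b c d x y : ℤ}
    (hd : legendreSym p d = 1) (hx : x ≠ 0)
    (ha : (p : ℤ) ∣ a) (hb : (p : ℤ) ∣ b) (hc : (p : ℤ) ∣ c) (hc9 : ¬ (p ^ 2 : ℤ) ∣ c)
    (h : cubicD a b c * x ^ 2 = d * y ^ 2) : 3 ∣ p - 1 := by
  have hp : p.Prime := Fact.out
  have hpp : Prime (p : ℤ) := Nat.prime_iff_prime_int.mp hp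
  have hd0 : (d : ZMod p) ≠ 0 := by
    intro h0
    rw [(legendreSym.eq_zero_iff p d).mpr h0] at hd
    exact zero_ne_one hd
  have hdp : ¬ (p : ℤ) ∣ d := by
    rwa [← ZMod.intCast_zmod_eq_zero_iff_dvd]
  have h3 : ¬ (p : ℤ) ∣ 3 := by
    intro h3
    have : p ∣ 3 := by exact_mod_cast h3
    exact hp3 ((Nat.prime_dvd_prime_iff_eq hp Nat.prime_three).mp this)
  have h2 : ¬ (p : ℤ) ∣ 2 := by
    intro h2
    have : p ∣ 2 := by exact_mod_cast h2
    exact hp2 ((Nat.prime_dvd_prime_iff_eq hp Nat.prime_two).mp this)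
  have h3z : (3 : ZMod p) ≠ 0 := by
    have := (ZMod.intCast_zmod_eq_zero_iff_dvd 3 p).not.mpr h3
    exact_mod_cast this
  have h2z : (2 : ZMod p) ≠ 0 := by
    have := (ZMod.intCast_zmod_eq_zero_iff_dvd 2 p).not.mpr h2
    exact_mod_cast this
  obtain ⟨a, rfl⟩ := ha
  obtain ⟨b, rfl⟩ := hb
  obtain ⟨c, rfl⟩ := hc
  have hc0 : ¬ (p : ℤ) ∣ c := by
    rintro ⟨c, rfl⟩
    exact hc9 ⟨c, by ring⟩
  have ⟨k, hk⟩ : ∃ k : ℤ, cubicD (p * a) (p * b) (p * c) = p ^ 2 * (- 27 * c ^ 2 + p * k) :=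
    ⟨p * a ^ 2 * b ^ 2 - 4 * b ^ 3 - 4 * p * a ^ 3 * c + 18 * a * b * c,
      by unfold cubicD; ring⟩
  rw [hk] at h
  have hcz : (c : ZMod p) ≠ 0 := by
    rwa [Ne, ZMod.intCast_zmod_eq_zero_iff_dvd]
  have hE : ¬ (p : ℤ) ∣ (- 27 * c ^ 2 + p * k) := by
    rw [← ZMod.intCast_zmod_eq_zero_iff_dvd]
    push_cast
    rw [ZMod.natCast_self, zero_mul, add_zero, show (-27 : ZMod p) = - 3 ^ 3 by norm_num]
    exact mul_ne_zero (neg_ne_zero.mpr (pow_ne_zero _ h3z)) (pow_ne_zero _ hcz)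
  obtain ⟨x', y', hx', hy', h'⟩ := unit_rel (E := - 27 * c ^ 2 + p * k) (x := p * x) (y := y)
    hpp hdp hE (mul_ne_zero hpp.ne_zero hx) (by rw [← h]; ring)
  have hxz : (x' : ZMod p) ≠ 0 := by
    rwa [Ne, ZMod.intCast_zmod_eq_zero_iff_dvd]
  have hz := congrArg (fun r : ℤ => (r : ZMod p)) h'
  push_cast at hz
  rw [ZMod.natCast_self, zero_mul, add_zero] at hz
  obtain ⟨r, hr⟩ := (legendreSym.eq_one_iff p hd0).mp hd
  rw [hr] at hz
  set w : ZMod p := r * y' / (3 * c * x') with hw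
  have hw3 : w ^ 2 = -3 := by
    rw [hw]; field_simp
    linear_combination -hz
  set ω : ZMod p := (-1 + w) / 2 with hω
  have hω2 : ω ^ 2 + ω + 1 = 0 := by
    rw [hω]; field_simp
    linear_combination hw3
  have hω3 : ω ^ 3 = 1 := by linear_combination (ω - 1) * hω2
  have hω1 : ω ≠ 1 := by
    intro h1
    rw [h1] at hω2
    apply h3z
    linear_combination hω2
  have hω0 : ω ≠ 0 := by
    intro h0
    rw [h0] at hω3
    simp at hω3
  have ho : orderOf ω = 3 := by
    have : Fact (Nat.Prime 3) := ⟨Nat.prime_three⟩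
    exact orderOf_eq_prime hω3 hω1
  rw [← ho]
  exact orderOf_dvd_of_pow_eq_one (ZMod.pow_card_sub_one_eq_one hω0)



section
variable {K : Type*} [Field K] [NumberField K]

lemma ram_absNorm (hK : Module.finrank ℚ K = 3) {p : ℕ} {P : Ideal (𝓞 K)}
    (h : Ideal.span {(p : 𝓞 K)} = P ^ 3) : Ideal.absNorm P = p := by
  have h1 := congrArg Ideal.absNorm h
  rw [Ideal.absNorm_span_natCast, RingOfIntegers.rank, hK, map_pow] at h1
  exact (Nat.pow_left_injective (n := 3) (by norm_num) h1).symm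

lemma ram_mem_int (hK : Module.finrank ℚ K = 3) {p : ℕ} (hp : p.Prime) {P : Ideal (𝓞 K)}
    (h : Ideal.span {(p : 𝓞 K)} = P ^ 3) (n : ℤ) : (n : 𝓞 K) ∈ P ↔ (p : ℤ) ∣ n := by
  have hN := ram_absNorm hK h
  rw [← hN]
  constructor
  · intro hn
    have := (Ideal.span_singleton_absNorm (I := P) (by rw [hN]; exact hp)).symm
    have h2 : n ∈ Ideal.comap (algebraMap ℤ (𝓞 K)) P := by simpa using hn
    rw [this, Ideal.mem_span_singleton] at h2
    exact h2
  · rintro ⟨k, rfl⟩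
    push_cast
    exact Ideal.mul_mem_right _ _ (Ideal.absNorm_mem P)

lemma ram_int_mem_cube {p : ℕ} {P : Ideal (𝓞 K)}
    (h : Ideal.span {(p : 𝓞 K)} = P ^ 3) {n : ℤ} (hn : (p : ℤ) ∣ n) : (n : 𝓞 K) ∈ P ^ 3 := by
  obtain ⟨k, rfl⟩ := hn
  rw [← h, Ideal.mem_span_singleton]
  exact ⟨k, by push_cast; ring⟩

lemma ram_exists_int (hK : Module.finrank ℚ K = 3) {p : ℕ} (hp : p.Prime) {P : Ideal (𝓞 K)}
    (h : Ideal.span {(p : 𝓞 K)} = P ^ 3) (α : 𝓞 K) : ∃ t : ℤ, α - t ∈ P := by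
  have hN := ram_absNorm hK h
  have : Fact p.Prime := ⟨hp⟩
  have : CharP (𝓞 K ⧸ P) p := by
    constructor
    intro n
    rw [← map_natCast (Ideal.Quotient.mk P), Ideal.Quotient.eq_zero_iff_mem]
    have := ram_mem_int hK hp h n
    rw [Int.natCast_dvd_natCast] at this
    rw [← this]; simp
  have hcard : Nat.card (𝓞 K ⧸ P) = p := by
    rw [← hN]; rfl
  have : Finite (𝓞 K ⧸ P) := Nat.finite_of_card_ne_zero (by rw [hcard]; exact hp.ne_zero)
  have : Fintype (𝓞 K ⧸ P) := Fintype.ofFinite _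
  have hbij := ZMod.castHom_bijective (𝓞 K ⧸ P) (n := p)
    (by rw [← Nat.card_eq_fintype_card, hcard])
  obtain ⟨t, ht⟩ := hbij.2 (Ideal.Quotient.mk P α)
  obtain ⟨t, rfl⟩ := ZMod.intCast_surjective t
  refine ⟨t, ?_⟩
  rw [← Ideal.Quotient.eq_zero_iff_mem, map_sub, ← ht]
  simp

lemma ram_pow_notMem {P : Ideal (𝓞 K)} (hP : P.IsPrime) (hP0 : P ≠ ⊥) {β : 𝓞 K} (h1 : β ∈ P)
    (h2 : β ∉ P ^ 2) (k : ℕ) : β ^ k ∉ P ^ (k + 1) := by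
  intro h
  have hPp : Prime P := (Ideal.prime_iff_isPrime hP0).mpr hP
  rw [← Ideal.dvd_span_singleton] at h1
  obtain ⟨J, hJ⟩ := h1
  rw [← Ideal.dvd_span_singleton, hJ, pow_two] at h2
  rw [← Ideal.dvd_span_singleton, ← Ideal.span_singleton_pow, hJ, mul_pow, pow_succ] at h
  have h3 : P ∣ J := hPp.dvd_of_dvd_pow ((mul_dvd_mul_iff_left (pow_ne_zero k hPp.ne_zero)).mp h)
  exact h2 (mul_dvd_mul_left P h3)

lemma ram_coeffs (hK : Module.finrank ℚ K = 3) {p : ℕ} (hp : p.Prime) {P : Ideal (𝓞 K)}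
    (hP : P.IsPrime) (h : Ideal.span {(p : 𝓞 K)} = P ^ 3) {β : 𝓞 K} (h1 : β ∈ P)
    (h2 : β ∉ P ^ 2) {a b c : ℤ} (he : β ^ 3 + a * β ^ 2 + b * β + c = 0) :
    (p : ℤ) ∣ a ∧ (p : ℤ) ∣ b ∧ (p : ℤ) ∣ c ∧ ¬ (p ^ 2 : ℤ) ∣ c := by
  have hP0 : P ≠ ⊥ := by
    rintro rfl
    have := ram_absNorm hK h
    rw [Ideal.absNorm_bot] at this
    exact hp.ne_zero this.symm
  have hc : (p : ℤ) ∣ c := by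
    rw [← ram_mem_int hK hp h]
    have : (c : 𝓞 K) = (-β ^ 2 - a * β - b) * β := by linear_combination he
    rw [this]
    exact Ideal.mul_mem_left _ _ h1
  have hc3 := ram_int_mem_cube h hc
  have hβ2 : β ^ 2 ∈ P ^ 2 := Ideal.pow_mem_pow h1 2
  have hβ3 : β ^ 3 ∈ P ^ 3 := Ideal.pow_mem_pow h1 3
  have hb : (p : ℤ) ∣ b := by
    rw [← ram_mem_int hK hp h]
    have e : (b : 𝓞 K) * β = -(β + a) * β ^ 2 - c := by linear_combination he
    have : (b : 𝓞 K) * β ∈ P ^ 2 := by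
      rw [e]
      exact sub_mem (Ideal.mul_mem_left _ _ hβ2) (Ideal.pow_le_pow_right (by norm_num) hc3)
    exact (Ideal.IsPrime.mul_mem_pow P this).resolve_right h2
  have hb3 := ram_int_mem_cube h hb
  have ha : (p : ℤ) ∣ a := by
    rw [← ram_mem_int hK hp h]
    have e : (a : 𝓞 K) * β ^ 2 = - β ^ 3 - b * β - c := by linear_combination he
    have : (a : 𝓞 K) * β ^ 2 ∈ P ^ 3 := by
      rw [e]
      exact sub_mem (sub_mem (neg_mem hβ3) (Ideal.mul_mem_right _ _ hb3)) hc3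
    exact (Ideal.IsPrime.mul_mem_pow P this).resolve_right (ram_pow_notMem hP hP0 h1 h2 2)
  refine ⟨ha, hb, hc, ?_⟩
  rintro ⟨k, rfl⟩
  apply ram_pow_notMem hP hP0 h1 h2 3
  have ha3 := ram_int_mem_cube h ha
  have e : β ^ 3 = - ((a : 𝓞 K) * β ^ 2) - b * β - ((p ^ 2 * k : ℤ) : 𝓞 K) := by
    linear_combination he
  rw [e]
  refine sub_mem (sub_mem (neg_mem ?_) ?_) ?_
  · exact Ideal.pow_le_pow_right (by norm_num : 4 ≤ 3 + 2) (by
      rw [pow_add]; exact Ideal.mul_mem_mul ha3 hβ2)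
  · rw [pow_succ]
    exact Ideal.mul_mem_mul hb3 h1
  · have hpp : ((p : ℤ) : 𝓞 K) ∈ P ^ 3 := ram_int_mem_cube h (dvd_refl _)
    push_cast
    apply Ideal.mul_mem_right
    rw [pow_two]
    refine Ideal.pow_le_pow_right (by norm_num : 4 ≤ 3 + 3) ?_
    rw [pow_add]
    exact Ideal.mul_mem_mul (by simpa using hpp) (by simpa using hpp)

/-- The modulus attached to `p`. -/
def modP (p : ℕ) : ℕ := if p = 3 then 9 else p

lemma modP_dvd_sq (p : ℕ) : modP p ∣ p ^ 2 := by
  unfold modP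
  split_ifs with h
  · subst h; norm_num
  · exact dvd_pow_self _ two_ne_zero

lemma modP_coprime {p n : ℕ} (h : Nat.Coprime n p) : Nat.Coprime n (modP p) :=
  Nat.Coprime.coprime_dvd_right (modP_dvd_sq p) (h.pow_right 2)

lemma isUnit_modP {p : ℕ} (hp : p.Prime) {t : ℤ} (ht : ¬ (p : ℤ) ∣ t) :
    IsUnit ((t : ℤ) : ZMod (modP p)) := by
  have hc : IsCoprime t (p : ℤ) :=
    ((Nat.prime_iff_prime_int.mp hp).coprime_iff_not_dvd.mpr ht).symm
  have hc2 : IsCoprime t (modP p : ℤ) :=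
    (hc.pow_right (n := 2)).of_isCoprime_of_dvd_right (by exact_mod_cast modP_dvd_sq p)
  obtain ⟨x, y, hxy⟩ := hc2
  have h1 := congrArg (Int.cast : ℤ → ZMod (modP p)) hxy
  push_cast at h1
  rw [ZMod.natCast_self, mul_zero, add_zero] at h1
  exact IsUnit.of_mul_eq_one_right _ h1

lemma zmod_three_sq : ∀ r : ZMod 3, r * r ≠ 0 → r * r = 1 := by decide

/-- The norm of an element prime to a ramified prime is a cube (modulo `p`, or 9). -/
lemma norm_cube_aux (hK : Module.finrank ℚ K = 3) {p : ℕ} [Fact p.Prime] {P : Ideal (𝓞 K)}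
    (hP : P.IsPrime) (h : Ideal.span {(p : 𝓞 K)} = P ^ 3) {d u v : ℤ}
    (hv : v ≠ 0) (hrel : d * u ^ 2 = NumberField.discr K * v ^ 2) (hd : legendreSym p d = 1)
    {β : 𝓞 K} (h1 : β ∈ P) (h2 : β ∉ P ^ 2) {t : ℤ} (ht : ¬ (p : ℤ) ∣ t) :
    ∃ z : (ZMod (modP p))ˣ, ((Algebra.norm ℤ (β + t) : ℤ) : ZMod (modP p)) = (z ^ 3 : _) := by
  have hp : p.Prime := Fact.out
  obtain ⟨a, b, c, s, he, hN, hD, -⟩ := cubic_data hK β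
  obtain ⟨ha, hb, hc, hc2⟩ := ram_coeffs hK hp hP h h1 h2 he
  obtain ⟨z, hz⟩ := isUnit_modP hp ht
  refine ⟨z, ?_⟩
  rw [Units.val_pow_eq_pow_val, hz]
  have hN1 := hN 1 t
  simp only [Int.cast_one, one_mul, mul_one, one_pow] at hN1
  rw [hN1, ← sub_eq_zero, ← Int.cast_pow, ← Int.cast_sub, ZMod.intCast_zmod_eq_zero_iff_dvd]
  have e : t ^ 3 - a * t ^ 2 + b * t - c - t ^ 3 = -a * t ^ 2 + b * t - c := by ring
  rw [e]
  unfold modP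
  split_ifs with h3
  · subst h3
    have hd3 : d % 3 = 1 := by
      have hd0 : (d : ZMod 3) ≠ 0 := by
        intro h0
        rw [(legendreSym.eq_zero_iff 3 d).mpr h0] at hd
        exact zero_ne_one hd
      obtain ⟨r, hr⟩ := (legendreSym.eq_one_iff 3 hd0).mp hd
      have hd1 : (d : ZMod 3) = 1 := by
        rw [hr] at hd0 ⊢
        exact zmod_three_sq r hd0
      have : ((d - 1 : ℤ) : ZMod 3) = 0 := by push_cast; rw [hd1]; simp
      have := (ZMod.intCast_zmod_eq_zero_iff_dvd _ 3).mp this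
      push_cast at this
      omega
    obtain ⟨hb9, hac⟩ := three_arith (x := v) (y := u * s) hd3 hv
      (by exact_mod_cast ha) (by exact_mod_cast hb) (by exact_mod_cast hc)
      (by simpa using hc2)
      (by rw [hD]; linear_combination (-s ^ 2) * hrel)
    push_cast at ha ht ⊢
    obtain ⟨k, hk⟩ := hb9
    obtain ⟨l, hl⟩ := hac
    obtain ⟨m, rfl⟩ := ha
    have ht2 : (3 : ℤ) ∣ t ^ 2 - 1 := by
      have : t % 3 = 1 ∨ t % 3 = 2 := by omega
      apply Int.dvd_of_emod_eq_zero
      rcases this with h | h <;> simp [pow_two, Int.sub_emod, Int.mul_emod, h]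
    obtain ⟨n, hn⟩ := ht2
    exact ⟨-m * n + k * t - l, by linear_combination (-3 * m) * hn + t * hk - hl⟩
  · exact dvd_sub (dvd_add (Dvd.dvd.mul_right (by simpa using ha) _) (Dvd.dvd.mul_right hb _)) hc

lemma ram_sq_ne {P : Ideal (𝓞 K)} (hP : P.IsPrime) (hP0 : P ≠ ⊥) : ∃ π ∈ P, π ∉ P ^ 2 := by
  have hlt : P ^ 2 < P := by
    simpa using Ideal.pow_lt_self P hP0 hP.ne_top 2 le_rfl
  exact SetLike.exists_of_lt hlt

lemma norm_cube (hK : Module.finrank ℚ K = 3) {p : ℕ} [Fact p.Prime] {P : Ideal (𝓞 K)}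
    (hP : P.IsPrime) (h : Ideal.span {(p : 𝓞 K)} = P ^ 3) {d u v : ℤ}
    (hv : v ≠ 0) (hrel : d * u ^ 2 = NumberField.discr K * v ^ 2) (hd : legendreSym p d = 1)
    {α : 𝓞 K} (hα : α ∉ P) :
    ∃ z : (ZMod (modP p))ˣ, ((Algebra.norm ℤ α : ℤ) : ZMod (modP p)) = (z ^ 3 : _) := by
  have hp : p.Prime := Fact.out
  have hP0 : P ≠ ⊥ := by
    rintro rfl
    have := ram_absNorm hK h
    rw [Ideal.absNorm_bot] at this
    exact hp.ne_zero this.symm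
  obtain ⟨t, ht⟩ := ram_exists_int hK hp h α
  have htp : ¬ (p : ℤ) ∣ t := by
    rw [← ram_mem_int hK hp h]
    intro h'
    apply hα
    have := add_mem ht h'
    simpa using this
  by_cases h2 : α - t ∈ P ^ 2
  · obtain ⟨π, hπ, hπ2⟩ := ram_sq_ne hP hP0
    have h1p : ¬ (p : ℤ) ∣ 1 := by
      intro h'
      exact (Nat.prime_iff_prime_int.mp hp).not_dvd_one h'
    obtain ⟨z, hz⟩ := norm_cube_aux hK hP h hv hrel hd hπ hπ2 h1p
    have hβ1 : t * π + (α - t) * (1 + π) ∈ P :=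
      add_mem (Ideal.mul_mem_left _ _ hπ) (Ideal.mul_mem_right _ _ ht)
    have hβ2 : t * π + (α - t) * (1 + π) ∉ P ^ 2 := by
      intro h'
      have h3 : (t : 𝓞 K) * π ∈ P ^ 2 := by
        have := sub_mem h' (Ideal.mul_mem_right (1 + π) _ h2)
        simpa using this
      rcases Ideal.IsPrime.mul_mem_pow P h3 with h4 | h4
      · exact htp ((ram_mem_int hK hp h t).mp h4)
      · exact hπ2 h4
    obtain ⟨w, hw⟩ := norm_cube_aux hK hP h hv hrel hd hβ1 hβ2 htp
    have e : t * π + (α - t) * (1 + π) + (t : 𝓞 K) = α * (π + ((1 : ℤ) : 𝓞 K)) := by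
      push_cast; ring
    rw [e, map_mul, Int.cast_mul, hz] at hw
    refine ⟨w * z⁻¹, ?_⟩
    rw [mul_pow, inv_pow, Units.val_mul]
    push_cast at hw ⊢
    rw [← hw, mul_assoc, ← Units.val_pow_eq_pow_val, ← Units.val_pow_eq_pow_val, ← Units.val_mul]
    simp
  · obtain ⟨z, hz⟩ := norm_cube_aux hK hP h hv hrel hd ht h2 htp
    exact ⟨z, by simpa using hz⟩

/-- `3` divides the order of the unit group modulo `modP p`. -/
lemma three_dvd_card_units (hK : Module.finrank ℚ K = 3) {p : ℕ} [Fact p.Prime] (hp2 : p ≠ 2)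
    {P : Ideal (𝓞 K)}
    (hP : P.IsPrime) (h : Ideal.span {(p : 𝓞 K)} = P ^ 3) {d u v : ℤ}
    (hv : v ≠ 0) (hrel : d * u ^ 2 = NumberField.discr K * v ^ 2) (hd : legendreSym p d = 1) :
    3 ∣ Nat.card (ZMod (modP p))ˣ := by
  have hp : p.Prime := Fact.out
  have hP0 : P ≠ ⊥ := by
    rintro rfl
    have := ram_absNorm hK h
    rw [Ideal.absNorm_bot] at this
    exact hp.ne_zero this.symm
  by_cases h3 : p = 3
  · have hm : modP p = 9 := if_pos h3
    rw [hm, Nat.card_eq_fintype_card, ZMod.card_units_eq_totient]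
    decide
  · have hm : modP p = p := if_neg h3
    rw [hm]
    obtain ⟨π, hπ, hπ2⟩ := ram_sq_ne hP hP0
    obtain ⟨a, b, c, s, he, hN, hD, -⟩ := cubic_data hK π
    obtain ⟨ha, hb, hc, hc2⟩ := ram_coeffs hK hp hP h hπ hπ2 he
    rw [Nat.card_eq_fintype_card, ZMod.card_units]
    exact three_dvd_sub_one (x := v) (y := u * s) h3 hp2 hd hv ha hb hc hc2
      (by rw [hD]; linear_combination (-s ^ 2) * hrel)
end



section
open scoped nonZeroDivisors

lemma exists_rep_not_le {R : Type*} [CommRing R] [IsDedekindDomain R] {P : Ideal R}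
    (hP : P.IsPrime) (hP0 : P ≠ ⊥) (C : ClassGroup R) :
    ∃ I : (Ideal R)⁰, ¬ (I : Ideal R) ≤ P ∧ ClassGroup.mk0 I = C := by
  obtain ⟨A, hA⟩ := ClassGroup.mk0_surjective C⁻¹
  have hA0 : (A : Ideal R) ≠ ⊥ := nonZeroDivisors.coe_ne_zero A
  have hlt : (A : Ideal R) * P < A := by
    refine lt_of_le_of_ne Ideal.mul_le_left ?_
    intro h
    have h2 : (A : Ideal R) * P = A * 1 := by rw [h, mul_one]
    have := mul_left_cancel₀ hA0 h2
    exact hP.ne_top (by rw [this, Ideal.one_eq_top])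
  obtain ⟨w, hwA, hw⟩ := SetLike.exists_of_lt hlt
  obtain ⟨B, hB⟩ := Ideal.dvd_span_singleton.mpr hwA
  have hw0 : w ≠ 0 := by
    rintro rfl
    exact hw (zero_mem _)
  have hB0 : B ≠ ⊥ := by
    rintro rfl
    rw [Ideal.mul_bot, Ideal.span_singleton_eq_bot] at hB
    exact hw0 hB
  refine ⟨⟨B, mem_nonZeroDivisors_of_ne_zero hB0⟩, ?_, ?_⟩
  · intro hBP
    apply hw
    have : Ideal.span {w} ≤ (A : Ideal R) * P := by
      rw [hB]; exact Ideal.mul_mono_right hBP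
    exact this (Ideal.mem_span_singleton_self w)
  · have h1 : ClassGroup.mk0 (A * ⟨B, mem_nonZeroDivisors_of_ne_zero hB0⟩) = 1 := by
      rw [ClassGroup.mk0_eq_one_iff]
      refine ⟨w, ?_⟩
      rw [Ideal.submodule_span_eq]
      exact hB.symm
    rw [map_mul, hA] at h1
    exact (inv_mul_eq_one.mp h1).symm

lemma exists_classHom {R G : Type*} [CommRing R] [IsDedekindDomain R] [CommGroup G] {P : Ideal R}
    (hP : P.IsPrime) (hP0 : P ≠ ⊥) (ν : Ideal R → G)
    (hmul : ∀ I J : Ideal R, ¬ I ≤ P → ¬ J ≤ P → ν (I * J) = ν I * ν J)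
    (hpr : ∀ x : R, x ∉ P → ν (Ideal.span {x}) = 1) :
    ∃ χ : ClassGroup R →* G, ∀ I : (Ideal R)⁰, ¬ (I : Ideal R) ≤ P → χ (ClassGroup.mk0 I) = ν I := by
  have hmulP : ∀ I J : Ideal R, ¬ I ≤ P → ¬ J ≤ P → ¬ I * J ≤ P := by
    intro I J hI hJ h
    rcases hP.mul_le.mp h with h | h
    · exact hI h
    · exact hJ h
  have key : ∀ I J : (Ideal R)⁰, ¬ (I : Ideal R) ≤ P → ¬ (J : Ideal R) ≤ P →
      ClassGroup.mk0 I = ClassGroup.mk0 J → ν I = ν J := by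
    intro I J hI hJ hIJ
    obtain ⟨w, hwI, hwP⟩ := SetLike.not_le_iff_exists.mp hI
    obtain ⟨B, hB⟩ := Ideal.dvd_span_singleton.mpr hwI
    have hw0 : w ≠ 0 := by
      rintro rfl
      exact hwP (zero_mem _)
    have hB0 : B ≠ ⊥ := by
      rintro rfl
      rw [Ideal.mul_bot, Ideal.span_singleton_eq_bot] at hB
      exact hw0 hB
    have hBP : ¬ B ≤ P := by
      intro hBP
      apply hwP
      have : Ideal.span {w} ≤ P := by
        rw [hB]; exact Ideal.mul_le_right.trans hBP
      exact this (Ideal.mem_span_singleton_self w)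
    let B' : (Ideal R)⁰ := ⟨B, mem_nonZeroDivisors_of_ne_zero hB0⟩
    have h1 : ClassGroup.mk0 (I * B') = 1 := by
      rw [ClassGroup.mk0_eq_one_iff]
      refine ⟨w, ?_⟩
      rw [Ideal.submodule_span_eq]
      exact hB.symm
    have h2 : ClassGroup.mk0 (J * B') = 1 := by
      rw [map_mul, ← hIJ, ← map_mul, h1]
    rw [ClassGroup.mk0_eq_one_iff] at h2
    obtain ⟨z, hz⟩ := h2
    rw [Ideal.submodule_span_eq] at hz
    have hz' : (J : Ideal R) * B = Ideal.span {z} := hz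
    have hzP : z ∉ P := by
      intro h
      apply hmulP J B hJ hBP
      rw [hz', Ideal.span_singleton_le_iff_mem]
      exact h
    have e1 := hpr w hwP
    have e2 := hpr z hzP
    rw [hB, hmul _ _ hI hBP] at e1
    rw [← hz', hmul _ _ hJ hBP, ← e1] at e2
    exact (mul_right_cancel e2).symm
  choose rep hrepP hrep using exists_rep_not_le (R := R) hP hP0
  refine ⟨MonoidHom.mk' (fun C => ν (rep C)) ?_, ?_⟩
  · intro C D
    change ν (rep (C * D)) = ν (rep C) * ν (rep D)
    rw [← hmul _ _ (hrepP C) (hrepP D)]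
    refine key (rep (C * D)) (rep C * rep D) (hrepP _) (hmulP _ _ (hrepP C) (hrepP D)) ?_
    rw [map_mul, hrep, hrep, hrep]
  · intro I hI
    exact key _ _ (hrepP _) hI (hrep _)

/-- Units modulo cubes. -/
def CubeQ (m : ℕ) : Type := (ZMod m)ˣ ⧸ (powMonoidHom 3 : (ZMod m)ˣ →* (ZMod m)ˣ).range

instance cubeQCommGroup (m : ℕ) : CommGroup (CubeQ m) :=
  QuotientGroup.Quotient.commGroup (powMonoidHom 3 : (ZMod m)ˣ →* (ZMod m)ˣ).range

/-- The projection to `CubeQ m`. -/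
def cubeMk (m : ℕ) : (ZMod m)ˣ →* CubeQ m :=
  QuotientGroup.mk' (powMonoidHom 3 : (ZMod m)ˣ →* (ZMod m)ˣ).range

lemma cubeMk_surj (m : ℕ) : Function.Surjective (cubeMk m) :=
  QuotientGroup.mk'_surjective _

lemma cubeMk_cube {m : ℕ} (z : (ZMod m)ˣ) : cubeMk m (z ^ 3) = 1 :=
  (QuotientGroup.eq_one_iff (N := (powMonoidHom 3 : (ZMod m)ˣ →* (ZMod m)ˣ).range) _).mpr ⟨z, rfl⟩

instance cubeQFinite (m : ℕ) [NeZero m] : Finite (CubeQ m) :=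
  Finite.of_surjective _ (cubeMk_surj m)

/-- The class of a natural number in `CubeQ m`. -/
def cubeClass (m n : ℕ) : CubeQ m :=
  if h : n.Coprime m then cubeMk m (ZMod.unitOfCoprime n h) else 1

lemma cubeClass_mul {m a b : ℕ} (ha : a.Coprime m) (hb : b.Coprime m) :
    cubeClass m (a * b) = cubeClass m a * cubeClass m b := by
  unfold cubeClass
  rw [dif_pos ha, dif_pos hb, dif_pos (Nat.Coprime.mul_left ha hb), ← map_mul]
  congr 1
  ext
  simp

lemma cubeQ_pow {m : ℕ} (g : CubeQ m) : g ^ 3 = 1 := by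
  obtain ⟨z, rfl⟩ := cubeMk_surj m g
  rw [← map_pow]
  exact cubeMk_cube z

lemma cubeClass_eq_one {m n : ℕ} {z : (ZMod m)ˣ} (hn : n.Coprime m)
    (h : (n : ZMod m) = (z ^ 3 : (ZMod m)ˣ)) : cubeClass m n = 1 := by
  unfold cubeClass
  have e : ZMod.unitOfCoprime n hn = z ^ 3 := by
    ext
    simpa using h
  rw [dif_pos hn, e, cubeMk_cube]

lemma three_dvd_card_cubeQ {m : ℕ} [NeZero m] (h : 3 ∣ Nat.card (ZMod m)ˣ) :
    3 ∣ Nat.card (CubeQ m) := by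
  have : Fact (Nat.Prime 3) := ⟨Nat.prime_three⟩
  have hpg : IsPGroup 3 (CubeQ m) := by
    intro g
    exact ⟨1, by simpa using cubeQ_pow g⟩
  obtain ⟨n, hn⟩ := IsPGroup.iff_card.mp hpg
  rw [hn]
  apply dvd_pow_self
  rintro rfl
  rw [pow_zero] at hn
  have htop : (powMonoidHom 3 : (ZMod m)ˣ →* (ZMod m)ˣ).range = ⊤ :=
    Subgroup.index_eq_one.mp hn
  have hsurj := MonoidHom.range_eq_top.mp htop
  have hinj := Finite.injective_iff_surjective.mpr hsurj
  obtain ⟨x, hx⟩ := exists_prime_orderOf_dvd_card' 3 h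
  have h1 : x ^ 3 = 1 := by rw [← hx]; exact pow_orderOf_eq_one x
  have : x = 1 := hinj (by simpa using h1)
  rw [this, orderOf_one] at hx
  norm_num at hx

variable {K : Type*} [Field K] [NumberField K]

lemma ram_coprime (hK : Module.finrank ℚ K = 3) {p : ℕ} (hp : p.Prime) {P : Ideal (𝓞 K)}
    (hP : P.IsPrime) (h : Ideal.span {(p : 𝓞 K)} = P ^ 3) {I : Ideal (𝓞 K)} (hI : ¬ I ≤ P) :
    (Ideal.absNorm I).Coprime p := by
  have hP0 : P ≠ ⊥ := by
    rintro rfl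
    have := ram_absNorm hK h
    rw [Ideal.absNorm_bot] at this
    exact hp.ne_zero this.symm
  rw [Nat.coprime_comm, hp.coprime_iff_not_dvd]
  intro hdvd
  obtain ⟨P', hP', hu, hd⟩ := Ideal.exists_isMaximal_dvd_of_dvd_absNorm' hp I hdvd
  have hpP' : (p : 𝓞 K) ∈ P' := by
    have : (p : ℤ) ∈ P'.under ℤ := by rw [hu]; exact Ideal.mem_span_singleton_self _
    simpa [Ideal.under, Ideal.mem_comap] using this
  have h3 : P ^ 3 ≤ P' := by rw [← h, Ideal.span_singleton_le_iff_mem]; exact hpP'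
  have h4 : P ≤ P' := hP'.isPrime.le_of_pow_le h3
  have hPm : P.IsMaximal := hP.isMaximal hP0
  have h5 : P = P' := hPm.eq_of_le hP'.ne_top h4
  subst h5
  exact hI (Ideal.le_of_dvd hd)

lemma exists_ramHom (hK : Module.finrank ℚ K = 3) {p : ℕ} [Fact p.Prime] {P : Ideal (𝓞 K)}
    (hP : P.IsPrime) (h : Ideal.span {(p : 𝓞 K)} = P ^ 3) {d u v : ℤ}
    (hv : v ≠ 0) (hrel : d * u ^ 2 = NumberField.discr K * v ^ 2) (hd : legendreSym p d = 1) :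
    ∃ χ : ClassGroup (𝓞 K) →* CubeQ (modP p), ∀ I : (Ideal (𝓞 K))⁰,
      (Ideal.absNorm (I : Ideal (𝓞 K))).Coprime p →
      χ (ClassGroup.mk0 I) = cubeClass (modP p) (Ideal.absNorm (I : Ideal (𝓞 K))) := by
  have hp : p.Prime := Fact.out
  have hP0 : P ≠ ⊥ := by
    rintro rfl
    have := ram_absNorm hK h
    rw [Ideal.absNorm_bot] at this
    exact hp.ne_zero this.symm
  obtain ⟨χ, hχ⟩ := exists_classHom hP hP0
    (fun I => cubeClass (modP p) (Ideal.absNorm I)) (by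
      intro I J hI hJ
      simp only [map_mul]
      exact cubeClass_mul (modP_coprime (ram_coprime hK hp hP h hI))
        (modP_coprime (ram_coprime hK hp hP h hJ))) (by
      intro x hx
      have hc := modP_coprime (ram_coprime hK hp hP h (I := Ideal.span {x})
        (by rwa [Ideal.span_singleton_le_iff_mem]))
      obtain ⟨z, hz⟩ := norm_cube hK hP h hv hrel hd hx
      rw [Ideal.absNorm_span_singleton] at hc ⊢
      rcases Int.natAbs_eq (Algebra.norm ℤ x) with hs | hs
      · refine cubeClass_eq_one (z := z) hc ?_
        rw [← hz]
        conv_rhs => rw [hs]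
        simp
      · refine cubeClass_eq_one (z := -z) hc ?_
        have h3 : (-z) ^ 3 = - z ^ 3 := by rw [Odd.neg_pow (by decide)]
        rw [h3, Units.val_neg, ← hz]
        conv_rhs => rw [hs]
        simp)
  refine ⟨χ, fun I hI => hχ I ?_⟩
  intro hle
  have := Ideal.absNorm_dvd_absNorm_of_le hle
  rw [ram_absNorm hK h] at this
  have h2 := Nat.Coprime.eq_one_of_dvd hI.symm this
  exact hp.ne_one h2
end


section

lemma jac_eq_of_modEq {d : ℤ} {a b : ℕ} (ha : Odd a) (hb : Odd b)
    (h : a ≡ b [MOD 4 * d.natAbs]) : jacobiSym d a = jacobiSym d b := by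
  rw [jacobiSym.mod_right d ha, jacobiSym.mod_right d hb, h]

lemma exists_prime_gt_modEq {m a : ℕ} (hm : m ≠ 0) (h : a.Coprime m) (N : ℕ) :
    ∃ q, N < q ∧ q.Prime ∧ q ≡ a [MOD m] := by
  have : NeZero m := ⟨hm⟩
  obtain ⟨q, h1, h2, h3⟩ := Nat.forall_exists_prime_gt_and_eq_mod
    ((ZMod.isUnit_iff_coprime a m).mpr h) N
  exact ⟨q, h1, h2, (ZMod.natCast_eq_natCast_iff _ _ _).mp h3⟩

lemma jac_nonres (d : ℤ) (hd : ¬ IsSquare d) (N : ℕ) :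
    ∃ q, N < q ∧ q.Prime ∧ jacobiSym d q = -1 := by
  have hd0 : d ≠ 0 := by rintro rfl; exact hd ⟨0, by simp⟩
  obtain ⟨a, k, hak, hsf⟩ := Nat.sq_mul_squarefree d.natAbs
  have hk0 : k ≠ 0 := by
    rintro rfl
    simp at hak
    exact hd0 (Int.natAbs_eq_zero.mp hak.symm)
  -- reduction to the squarefree part
  suffices H : ∀ ε : ℤ, (ε = 1 ∨ ε = -1) → (ε * a ≠ 1) → ∃ q, max N k < q ∧ q.Prime ∧
      jacobiSym (ε * a) q = -1 by
    have hε : ∃ ε : ℤ, (ε = 1 ∨ ε = -1) ∧ d = ε * a * k ^ 2 := by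
      rcases Int.natAbs_eq d with h | h
      · refine ⟨1, Or.inl rfl, ?_⟩
        rw [h, ← hak]; push_cast; ring
      · refine ⟨-1, Or.inr rfl, ?_⟩
        rw [h, ← hak]; push_cast; ring
    obtain ⟨ε, hε, hdε⟩ := hε
    obtain ⟨q, hq, hqp, hJ⟩ := H ε hε (by
      intro h1
      rw [h1, one_mul] at hdε
      exact hd ⟨k, by rw [hdε, pow_two]⟩)
    refine ⟨q, lt_of_le_of_lt (le_max_left _ _) hq, hqp, ?_⟩
    rw [hdε, jacobiSym.mul_left, hJ, jacobiSym.pow_left, jacobiSym.sq_one, mul_one]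
    rw [Int.gcd_natCast_natCast]
    exact (Nat.coprime_of_lt_prime hk0 (lt_of_le_of_lt (le_max_right _ _) hq) hqp).symm
  intro ε hε h1
  by_cases hodd : ∃ l : ℕ, l.Prime ∧ l ≠ 2 ∧ l ∣ a
  · obtain ⟨l, hl, hl2, t, rfl⟩ := hodd
    have hlt : l.Coprime t := by
      rw [Nat.squarefree_mul_iff] at hsf
      exact hsf.1
    have ht0 : t ≠ 0 := by
      rintro rfl
      simp at hsf
    have : Fact l.Prime := ⟨hl⟩
    obtain ⟨r, hr⟩ := FiniteField.exists_nonsquare (F := ZMod l) (by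
      rw [ZMod.ringChar_zmod_n]; exact hl2)
    obtain ⟨r, rfl⟩ := ZMod.natCast_zmod_surjective r
    have hrl : r.Coprime l := by
      rw [← ZMod.isUnit_iff_coprime, isUnit_iff_ne_zero]
      intro h0
      exact hr (by rw [h0]; exact ⟨0, by simp⟩)
    have hl8 : (8 * t).Coprime l := by
      refine Nat.Coprime.mul_left ?_ hlt.symm
      have : (2 : ℕ).Coprime l := (Nat.coprime_primes Nat.prime_two hl).mpr hl2.symm
      exact this.pow_left 3
    obtain ⟨x, hx1, hx2⟩ := Nat.chineseRemainder hl8 1 r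
    have hx : x.Coprime (8 * t * l) := by
      refine Nat.Coprime.mul_right ?_ ?_
      · rw [Nat.Coprime, hx1.gcd_eq]; simp
      · rw [Nat.Coprime, hx2.gcd_eq]; exact hrl
    obtain ⟨q, hq, hqp, hqx⟩ := exists_prime_gt_modEq
      (by have := hl.ne_zero; positivity) hx (max N k)
    refine ⟨q, hq, hqp, ?_⟩
    have hq8 : q ≡ 1 [MOD 8 * t] := (hqx.of_dvd (Dvd.intro _ rfl)).trans hx1
    have hql : q ≡ r [MOD l] := (hqx.of_dvd (Dvd.intro_left _ rfl)).trans hx2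
    have hq4 : q % 4 = 1 := by
      have : q ≡ 1 [MOD 4] := hq8.of_dvd ⟨2 * t, by ring⟩
      exact this
    have hqodd : Odd q := by
      rw [Nat.odd_iff]; omega
    have e1 : jacobiSym (ε * t) q = 1 := by
      rw [jac_eq_of_modEq hqodd odd_one, jacobiSym.one_right]
      apply hq8.of_dvd
      have : (ε * t).natAbs = t := by
        rcases hε with rfl | rfl <;> simp
      rw [this]
      exact ⟨2, by ring⟩
    have e2 : jacobiSym l q = -1 := by
      rw [← jacobiSym.quadratic_reciprocity_one_mod_four hq4 (hl.odd_of_ne_two hl2),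
        ← jacobiSym.legendreSym.to_jacobiSym, legendreSym.eq_neg_one_iff]
      have : ((q : ℤ) : ZMod l) = (r : ZMod l) := by
        rw [Int.cast_natCast]
        exact (ZMod.natCast_eq_natCast_iff _ _ _).mpr hql
      rw [this]
      exact hr
    have e3 : ε * ((l * t : ℕ) : ℤ) = l * (ε * t) := by push_cast; ring
    rw [e3, jacobiSym.mul_left, e1, e2, mul_one]
  · push Not at hodd
    have ha : a = 1 ∨ a = 2 := by
      by_cases ha1 : a = 1
      · exact Or.inl ha1
      · obtain ⟨l, hl, hla⟩ := Nat.exists_prime_and_dvd ha1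
        have hl2 : l = 2 := by
          by_contra h
          exact hodd l hl h hla
        subst hl2
        obtain ⟨b, rfl⟩ := hla
        by_cases hb1 : b = 1
        · right; simp [hb1]
        · exfalso
          obtain ⟨l, hl, hlb⟩ := Nat.exists_prime_and_dvd hb1
          have hl2 : l = 2 := by
            by_contra h
            exact hodd l hl h (hlb.mul_left 2)
          subst hl2
          have := hsf 2 (mul_dvd_mul_left 2 hlb)
          simp at this
    have key : ∀ (s : ℤ) (m r : ℕ), m = 4 * s.natAbs → m ≠ 0 → r.Coprime m → r % 2 = 1 →
        jacobiSym s r = -1 →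
        ∃ q, max N k < q ∧ q.Prime ∧ jacobiSym s q = -1 := by
      intro s m r hm hm0 hr hr2 hJ
      obtain ⟨q, hq, hqp, hqr⟩ := exists_prime_gt_modEq hm0 hr (max N k)
      refine ⟨q, hq, hqp, ?_⟩
      have h2 : q ≡ r [MOD 2] := hqr.of_dvd (by rw [hm]; exact ⟨2 * s.natAbs, by ring⟩)
      rw [jac_eq_of_modEq (b := r) _ _ (hm ▸ hqr), hJ]
      · rw [Nat.odd_iff, ← hr2]; exact h2
      · rw [Nat.odd_iff, hr2]
    rcases hε with rfl | rfl <;> rcases ha with rfl | rfl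
    · simp at h1
    · exact key _ 8 5 (by norm_num) (by norm_num) (by norm_num) (by norm_num) (by norm_num)
    · exact key _ 4 3 (by norm_num) (by norm_num) (by norm_num) (by norm_num) (by norm_num)
    · exact key _ 8 5 (by norm_num) (by norm_num) (by norm_num) (by norm_num) (by norm_num)

lemma cubeClass_congr {m a b : ℕ} (h : a ≡ b [MOD m]) : cubeClass m a = cubeClass m b := by
  have hab : a.Coprime m ↔ b.Coprime m := by
    unfold Nat.Coprime
    rw [h.gcd_eq]
  unfold cubeClass
  by_cases ha : a.Coprime m
  · rw [dif_pos ha, dif_pos (hab.mp ha)]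
    congr 1
    ext
    simpa using (ZMod.natCast_eq_natCast_iff _ _ _).mpr h
  · rw [dif_neg ha, dif_neg (fun h => ha (hab.mpr h))]

lemma cubeClass_surj {m : ℕ} [NeZero m] (g : CubeQ m) : ∃ n, n.Coprime m ∧ cubeClass m n = g := by
  obtain ⟨z, rfl⟩ := cubeMk_surj m g
  have hc : ((z : ZMod m).val).Coprime m := ZMod.val_coe_unit_coprime z
  refine ⟨(z : ZMod m).val, hc, ?_⟩
  unfold cubeClass
  rw [dif_pos hc]
  congr 1
  ext
  simp

/-- A prime number with given cubic residue classes, for which `d` is a nonresidue. -/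
lemma exists_prime_target {ι : Type*} [Fintype ι] (m : ι → ℕ) (hm : ∀ i, m i ≠ 0)
    (hc : Pairwise (Function.onFun Nat.Coprime m)) (g : ∀ i, CubeQ (m i))
    (d : ℤ) (hd : ¬ IsSquare d) (N : ℕ) :
    ∃ q, N < q ∧ q.Prime ∧ jacobiSym d q = -1 ∧ ∀ i, cubeClass (m i) q = g i := by
  have hd0 : d ≠ 0 := by rintro rfl; exact hd ⟨0, by simp⟩
  have := fun i => (⟨hm i⟩ : NeZero (m i))
  choose n hn hng using fun i => cubeClass_surj (g i)
  obtain ⟨x, hx⟩ := Nat.chineseRemainderOfFinset n m Finset.univ (fun i _ => hm i)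
    (fun i _ j _ hij => hc hij)
  have hxc : x.Coprime (∏ i, m i) := by
    apply Nat.Coprime.prod_right
    intro i _
    rw [Nat.Coprime, (hx i (Finset.mem_univ i)).gcd_eq]
    exact hn i
  have hprod : ∏ i, m i ≠ 0 := Finset.prod_ne_zero_iff.mpr fun i _ => hm i
  set M := 4 * d.natAbs * ∏ i, m i with hM
  have hM0 : M ≠ 0 := by
    have : d.natAbs ≠ 0 := Int.natAbs_ne_zero.mpr hd0
    positivity
  obtain ⟨b, hb, hbp, hbx⟩ := exists_prime_gt_modEq hprod hxc M
  obtain ⟨a, ha, hap, hJa⟩ := jac_nonres d hd M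
  have hbM : b.Coprime M := Nat.coprime_of_lt_prime hM0 hb hbp
  have haM : a.Coprime M := Nat.coprime_of_lt_prime hM0 ha hap
  have hnM : (a ^ 3 * b ^ 4).Coprime M := (haM.pow_left 3).mul_left (hbM.pow_left 4)
  obtain ⟨q, hq, hqp, hqn⟩ := exists_prime_gt_modEq hM0 hnM (max N 2)
  have hM2 : 2 ∣ M := ⟨2 * d.natAbs * ∏ i, m i, by rw [hM]; ring⟩
  have hMd : 4 * d.natAbs ∣ M := Dvd.intro _ rfl
  refine ⟨q, lt_of_le_of_lt (le_max_left _ _) hq, hqp, ?_, ?_⟩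
  · have hnodd : Odd (a ^ 3 * b ^ 4) := by
      rw [← Nat.coprime_two_right]
      exact hnM.coprime_dvd_right hM2
    have hqodd : Odd q := hqp.odd_of_ne_two (by
      have := lt_of_le_of_lt (le_max_right N 2) hq
      omega)
    rw [jac_eq_of_modEq hqodd hnodd (hqn.of_dvd hMd)]
    have := fun k => (⟨pow_ne_zero k hap.ne_zero⟩ : NeZero (a ^ k))
    have := fun k => (⟨pow_ne_zero k hbp.ne_zero⟩ : NeZero (b ^ k))
    rw [jacobiSym.mul_right, jacobiSym.pow_right, jacobiSym.pow_right, hJa]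
    have hsq : jacobiSym d b ^ 2 = 1 := by
      apply jacobiSym.sq_one
      rw [Int.gcd_eq_natAbs, Int.natAbs_natCast]
      exact (hbM.coprime_dvd_right ((Dvd.intro_left 4 rfl).trans hMd)).symm
    have h4 : jacobiSym d b ^ 4 = (jacobiSym d b ^ 2) ^ 2 := by ring
    rw [h4, hsq]
    norm_num
  · intro i
    have hmi : m i ∣ ∏ i, m i := Finset.dvd_prod_of_mem m (Finset.mem_univ i)
    have hmM : m i ∣ M := hmi.mul_left _
    have hai := haM.coprime_dvd_right hmM
    have hbi := hbM.coprime_dvd_right hmM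
    have e : a ^ 3 * b ^ 4 = (a * a * a) * (b * b * b) * b := by ring
    have h3 : ∀ g : CubeQ (m i), g * g * g = 1 := fun g => by
      rw [← pow_two, ← pow_succ]; exact cubeQ_pow g
    have h4 : ∀ x y z : CubeQ (m i), (x * x * x) * (y * y * y) * z = z := by
      intro x y z
      calc (x * x * x) * (y * y * y) * z = 1 * 1 * z := by rw [h3 x, h3 y]
        _ = z := by simp
    rw [cubeClass_congr (hqn.of_dvd hmM), e,
      cubeClass_mul (((hai.mul_left hai).mul_left hai).mul_left ((hbi.mul_left hbi).mul_left hbi)) hbi,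
      cubeClass_mul ((hai.mul_left hai).mul_left hai) ((hbi.mul_left hbi).mul_left hbi),
      cubeClass_mul (hai.mul_left hai) hai, cubeClass_mul hai hai,
      cubeClass_mul (hbi.mul_left hbi) hbi, cubeClass_mul hbi hbi, h4,
      cubeClass_congr (hbx.of_dvd hmi), cubeClass_congr (hx i (Finset.mem_univ i))]
    exact hng i
end


section

lemma frob_fixed_int {F : Type*} [Field F] {q : ℕ} [Fact q.Prime] [CharP F q] {x : F}
    (hx : x ^ q = x) : ∃ t : ℤ, x = t := by
  classical
  have hq : q.Prime := Fact.out
  have hne : (X ^ q - X : F[X]) ≠ 0 := FiniteField.X_pow_card_sub_X_ne_zero F hq.one_lt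
  have hdeg : (X ^ q - X : F[X]).natDegree = q :=
    FiniteField.X_pow_card_sub_X_natDegree_eq F hq.one_lt
  set φ := ZMod.castHom (dvd_refl q) F
  have hφ : Function.Injective φ := φ.injective
  have hsub : Finset.univ.image φ ⊆ (X ^ q - X : F[X]).roots.toFinset := by
    intro y hy
    obtain ⟨z, -, rfl⟩ := Finset.mem_image.mp hy
    rw [Multiset.mem_toFinset, mem_roots hne]
    simp only [IsRoot.def, eval_sub, eval_pow, eval_X]
    rw [← map_pow, ZMod.pow_card, sub_self]
  have hcard : (X ^ q - X : F[X]).roots.toFinset.card ≤ (Finset.univ.image φ).card := by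
    rw [Finset.card_image_of_injective _ hφ, Finset.card_univ, ZMod.card]
    exact (Multiset.toFinset_card_le _).trans ((card_roots' _).trans hdeg.le)
  have heq := Finset.eq_of_subset_of_card_le hsub hcard
  have hxm : x ∈ Finset.univ.image φ := by
    rw [heq, Multiset.mem_toFinset, mem_roots hne]
    simp [hx]
  obtain ⟨z, -, rfl⟩ := Finset.mem_image.mp hxm
  obtain ⟨t, rfl⟩ := ZMod.intCast_surjective z
  exact ⟨t, by simp⟩

lemma cubic_disc_sq {F : Type*} [Field F] {a b c x y z : F} (hxy : x ≠ y) (hyz : y ≠ z)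
    (hxz : x ≠ z) (hx : x ^ 3 + a * x ^ 2 + b * x + c = 0) (hy : y ^ 3 + a * y ^ 2 + b * y + c = 0)
    (hz : z ^ 3 + a * z ^ 2 + b * z + c = 0) :
    a ^ 2 * b ^ 2 - 4 * b ^ 3 - 4 * a ^ 3 * c - 27 * c ^ 2 + 18 * a * b * c =
      ((x - y) * (y - z) * (z - x)) ^ 2 := by
  have h1 : x ^ 2 + x * y + y ^ 2 + a * (x + y) + b = 0 := by
    apply mul_left_cancel₀ (sub_ne_zero.mpr hxy)
    linear_combination hx - hy
  have h2 : y ^ 2 + y * z + z ^ 2 + a * (y + z) + b = 0 := by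
    apply mul_left_cancel₀ (sub_ne_zero.mpr hyz)
    linear_combination hy - hz
  have ha : a = -(x + y + z) := by
    apply mul_left_cancel₀ (sub_ne_zero.mpr hxz)
    linear_combination h1 - h2
  have hb : b = x * y + y * z + z * x := by
    rw [ha] at h1
    linear_combination h1
  have hc : c = - (x * y * z) := by
    rw [ha, hb] at hx
    linear_combination hx
  rw [ha, hb, hc]
  ring

variable {K : Type*} [Field K] [NumberField K]

lemma not_inert (hK : Module.finrank ℚ K = 3) {q : ℕ} [Fact q.Prime] {θ : 𝓞 K} {a b c : ℤ}
    (hθ : θ ^ 3 + a * θ ^ 2 + b * θ + c = 0)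
    (hprim : ∀ η : 𝓞 K, ∀ q t : ℤ, θ = t + q * η → q ∣ cubicD a b c)
    (hq : ¬ (q : ℤ) ∣ cubicD a b c) (hns : ¬ IsSquare (cubicD a b c : ZMod q)) :
    ¬ (Ideal.span {(q : 𝓞 K)}).IsMaximal := by
  intro hmax
  have hqp : q.Prime := Fact.out
  set I := Ideal.span {(q : 𝓞 K)} with hI
  let F := 𝓞 K ⧸ I
  letI : Field F := Ideal.Quotient.field I
  have hcard : Nat.card F = q ^ 3 := by
    have := Ideal.absNorm_span_natCast (S := 𝓞 K) q
    rw [RingOfIntegers.rank, hK] at this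
    rw [← this]; rfl
  have : Finite F := Nat.finite_of_card_ne_zero (by rw [hcard]; exact pow_ne_zero _ hqp.ne_zero)
  have : Fintype F := Fintype.ofFinite _
  have hq0 : (q : F) = 0 := by
    have : Ideal.Quotient.mk I (q : 𝓞 K) = 0 :=
      Ideal.Quotient.eq_zero_iff_mem.mpr (Ideal.mem_span_singleton_self _)
    rw [map_natCast] at this
    exact this
  have hchar : CharP F q := (CharP.charP_iff_prime_eq_zero hqp).mpr hq0
  set π : 𝓞 K →+* F := Ideal.Quotient.mk I with hπ
  set x := π θ with hxdef
  have hx : x ^ 3 + a * x ^ 2 + b * x + c = 0 := by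
    have := congrArg π hθ
    simpa only [map_add, map_mul, map_pow, map_intCast, map_zero] using this
  have hfrob : ∀ y : F, y ^ 3 + a * y ^ 2 + b * y + c = 0 →
      (y ^ q) ^ 3 + a * (y ^ q) ^ 2 + b * y ^ q + c = 0 := by
    intro y hy
    have := congrArg (frobenius F q) hy
    simpa only [map_add, map_mul, map_pow, map_intCast, map_zero, frobenius_def] using this
  have hy := hfrob x hx
  have hz := hfrob _ hy
  have hx3 : ((x ^ q) ^ q) ^ q = x := by
    rw [← pow_mul, ← pow_mul]
    have := FiniteField.pow_card x
    rw [← Nat.card_eq_fintype_card, hcard] at this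
    rw [show q * (q * q) = q ^ 3 by ring]
    exact this
  have hinj : ∀ y z : F, y ^ q = z ^ q → y = z := fun y z h => frobenius_inj F q h
  have hxy : x ≠ x ^ q := by
    intro h
    obtain ⟨t, ht⟩ := frob_fixed_int h.symm
    have hm : θ - t ∈ I := by
      rw [← Ideal.Quotient.eq_zero_iff_mem, map_sub, map_intCast]
      exact sub_eq_zero.mpr ht
    rw [hI, Ideal.mem_span_singleton] at hm
    obtain ⟨η, hη⟩ := hm
    exact hq (hprim η q t (by push_cast; linear_combination hη))
  have hyz : x ^ q ≠ (x ^ q) ^ q := fun h => hxy (hinj _ _ h)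
  have hxz : x ≠ (x ^ q) ^ q := by
    intro h
    have h2 := congrArg (fun y => y ^ q) h
    simp only [hx3] at h2
    exact hxy h2.symm
  have hD := cubic_disc_sq hxy hyz hxz hx hy hz
  set δ := (x - x ^ q) * (x ^ q - (x ^ q) ^ q) * ((x ^ q) ^ q - x) with hδ
  have hδq : δ ^ q = δ := by
    have h := congrArg (frobenius F q) hδ
    simp only [map_mul, map_sub, frobenius_def, hx3] at h
    rw [h, hδ]
    ring
  obtain ⟨t, ht⟩ := frob_fixed_int hδq
  apply hns
  refine ⟨t, ?_⟩
  have e : ((cubicD a b c - t * t : ℤ) : F) = 0 := by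
    unfold cubicD
    push_cast
    rw [hD, ht]
    ring
  rw [CharP.intCast_eq_zero_iff F q] at e
  have := (ZMod.intCast_zmod_eq_zero_iff_dvd _ q).mpr e
  push_cast at this
  linear_combination this

open scoped nonZeroDivisors in
lemma exists_ideal_norm (hK : Module.finrank ℚ K = 3) {q : ℕ} (hq : q.Prime)
    (h : ¬ (Ideal.span {(q : 𝓞 K)}).IsMaximal) :
    ∃ I : (Ideal (𝓞 K))⁰, Ideal.absNorm (I : Ideal (𝓞 K)) = q ∨
      Ideal.absNorm (I : Ideal (𝓞 K)) = q * q := by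
  have hN : Ideal.absNorm (Ideal.span {(q : 𝓞 K)}) = q ^ 3 := by
    have := Ideal.absNorm_span_natCast (S := 𝓞 K) q
    rwa [RingOfIntegers.rank, hK] at this
  have hne : Ideal.span {(q : 𝓞 K)} ≠ ⊤ := by
    intro ht
    rw [ht, Ideal.absNorm_top] at hN
    have := Nat.one_lt_pow (n := 3) (by norm_num) hq.one_lt
    omega
  obtain ⟨M, hM, hle⟩ := Ideal.exists_le_maximal _ hne
  obtain ⟨J, hJ⟩ := Ideal.dvd_iff_le.mpr hle
  have hM0 : M ≠ ⊥ := by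
    rintro rfl
    have : (q : 𝓞 K) = 0 := by
      rw [le_bot_iff, Ideal.span_singleton_eq_bot] at hle
      exact hle
    exact hq.ne_zero (by exact_mod_cast this)
  refine ⟨⟨M, mem_nonZeroDivisors_of_ne_zero hM0⟩, ?_⟩
  change Ideal.absNorm M = q ∨ Ideal.absNorm M = q * q
  have hmul : Ideal.absNorm M * Ideal.absNorm J = q ^ 3 := by rw [← map_mul, ← hJ, hN]
  obtain ⟨k, hk, hMk⟩ := (Nat.dvd_prime_pow hq).mp (Dvd.intro _ hmul)
  interval_cases k
  · rw [pow_zero, Ideal.absNorm_eq_one_iff] at hMk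
    exact absurd hMk hM.ne_top
  · left; simpa using hMk
  · right; rw [hMk, pow_two]
  · exfalso
    rw [hMk] at hmul
    have : Ideal.absNorm J = 1 := by
      have h0 : 0 < q ^ 3 := pow_pos hq.pos 3
      exact Nat.eq_of_mul_eq_mul_left h0 (by rw [hmul, mul_one])
    rw [Ideal.absNorm_eq_one_iff] at this
    rw [this, Ideal.mul_top] at hJ
    exact h (hJ ▸ hM)
end


section
variable {K : Type*} [Field K] [NumberField K]

lemma jac_sq_one {x : ℤ} {q : ℕ} (hq : q.Prime) (hx : x ≠ 0) (hlt : x.natAbs < q) :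
    jacobiSym x q ^ 2 = 1 := by
  apply jacobiSym.sq_one
  rw [Int.gcd_eq_natAbs, Int.natAbs_natCast]
  exact (Nat.coprime_of_lt_prime (Int.natAbs_ne_zero.mpr hx) hlt hq).symm

theorem pow_dvd_nonsquare (hK : Module.finrank ℚ K = 3) {d u v : ℤ} (hd : ¬ IsSquare d)
    (hu : u ≠ 0) (hv : v ≠ 0) (hrel : d * u ^ 2 = NumberField.discr K * v ^ 2)
    (S : Set ℕ) [Fintype S] (hS : ∀ p ∈ S, ∃ hp : p.Prime, Odd p ∧ TotallyRamified p K ∧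
      @legendreSym p ⟨hp⟩ d = 1) : 3 ^ Fintype.card S ∣ NumberField.classNumber K := by
  have hprime : ∀ p : S, (p : ℕ).Prime := fun p => (hS p p.2).1
  have hfact : ∀ p : S, Fact (p : ℕ).Prime := fun p => ⟨hprime p⟩
  have hm0 : ∀ p : S, modP p ≠ 0 := by
    intro p
    unfold modP
    split_ifs
    · norm_num
    · exact (hprime p).ne_zero
  have hne : ∀ p : S, NeZero (modP p) := fun p => ⟨hm0 p⟩
  have hmc : Pairwise (Function.onFun Nat.Coprime (fun p : S => modP p)) := by
    intro p p' hpp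
    have h1 : (p : ℕ).Coprime p' := (Nat.coprime_primes (hprime p) (hprime p')).mpr
      (fun h => hpp (Subtype.ext h))
    exact modP_coprime (modP_coprime h1.symm).symm
  have hχ : ∀ p : S, ∃ χ : ClassGroup (𝓞 K) →* CubeQ (modP p),
      ∀ I : nonZeroDivisors (Ideal (𝓞 K)),
      (Ideal.absNorm (I : Ideal (𝓞 K))).Coprime p →
      χ (ClassGroup.mk0 I) = cubeClass (modP p) (Ideal.absNorm (I : Ideal (𝓞 K))) := by
    intro p
    obtain ⟨hp, -, ⟨P, hP, hP3⟩, hleg⟩ := hS p p.2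
    exact exists_ramHom hK hP hP3 hv hrel hleg
  choose χ hχ using hχ
  let Φ : ClassGroup (𝓞 K) →* (∀ p : S, CubeQ (modP p)) := Pi.monoidHom χ
  have hsurj : Function.Surjective Φ := by
    intro g
    obtain ⟨θ, a, b, c, s, -, hθ, hprim, hD, hs⟩ := primitive_data hK
    have hD0 : cubicD a b c ≠ 0 := by
      rw [hD]; exact mul_ne_zero (NumberField.discr_ne_zero K) (pow_ne_zero 2 hs)
    obtain ⟨q, hqN, hq, hJ, hqg⟩ := exists_prime_target (fun p : S => modP p) hm0 hmc g d hd
      ((cubicD a b c).natAbs + u.natAbs + v.natAbs + s.natAbs + ∑ p : S, (p : ℕ))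
    have hqp : ∀ p : S, q.Coprime p := by
      intro p
      refine Nat.coprime_of_lt_prime (hprime p).ne_zero ?_ hq
      have : (p : ℕ) ≤ ∑ p : S, (p : ℕ) :=
        Finset.single_le_sum (f := fun p : S => (p : ℕ)) (fun _ _ => Nat.zero_le _)
          (Finset.mem_univ p)
      omega
    have hqf : Fact q.Prime := ⟨hq⟩
    have hJD : jacobiSym (cubicD a b c) q = -1 := by
      have e : cubicD a b c * v ^ 2 = d * u ^ 2 * s ^ 2 := by
        rw [hD]; linear_combination (-s ^ 2) * hrel
      have := congrArg (fun x => jacobiSym x q) e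
      simp only [jacobiSym.mul_left, jacobiSym.pow_left] at this
      rw [jac_sq_one hq hv (by omega), jac_sq_one hq hu (by omega),
        jac_sq_one hq hs (by omega), hJ] at this
      simpa using this
    rw [← jacobiSym.legendreSym.to_jacobiSym, legendreSym.eq_neg_one_iff] at hJD
    have hqD : ¬ (q : ℤ) ∣ cubicD a b c := by
      rw [Int.natCast_dvd]
      exact Nat.not_dvd_of_pos_of_lt (Int.natAbs_pos.mpr hD0) (by omega)
    obtain ⟨I, hI⟩ := exists_ideal_norm hK hq (not_inert hK hθ hprim hqD hJD)
    rcases hI with hI | hI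
    · refine ⟨ClassGroup.mk0 I, ?_⟩
      funext p
      change χ p (ClassGroup.mk0 I) = g p
      rw [hχ p I (by rw [hI]; exact hqp p), hI]
      exact hqg p
    · refine ⟨ClassGroup.mk0 I * ClassGroup.mk0 I, ?_⟩
      funext p
      change χ p (ClassGroup.mk0 I * ClassGroup.mk0 I) = g p
      rw [map_mul, hχ p I (by rw [hI]; exact (hqp p).mul_left (hqp p)), hI,
        cubeClass_mul (modP_coprime (hqp p)) (modP_coprime (hqp p)), hqg p]
      have h3 := cubeQ_pow (g p)
      calc g p * g p * (g p * g p) = g p ^ 3 * g p := by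
            rw [pow_succ, pow_two]; simp only [mul_assoc]
        _ = g p := by rw [h3, one_mul]
  have hdvd := Subgroup.card_dvd_of_surjective Φ hsurj
  rw [Nat.card_pi] at hdvd
  rw [Nat.card_eq_fintype_card] at hdvd
  refine dvd_trans ?_ hdvd
  rw [← Finset.card_univ, ← Finset.prod_const]
  apply Finset.prod_dvd_prod_of_dvd
  intro p _
  obtain ⟨hp, hodd, ⟨P, hP, hP3⟩, hleg⟩ := hS p p.2
  apply three_dvd_card_cubeQ
  refine three_dvd_card_units hK ?_ hP hP3 hv hrel hleg
  intro h2
  rw [h2] at hodd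
  exact absurd hodd (by decide)
end


section

lemma index_cube_le {M : Type*} [CommGroup M] {r : ℕ} (b : Module.Basis (Fin r) ℤ (Additive M)) :
    (powMonoidHom 3 : M →* M).range.index ≠ 0 ∧ (powMonoidHom 3 : M →* M).range.index ≤ 3 ^ r := by
  let f : M →* Multiplicative (Fin r → ZMod 3) := MonoidHom.mk'
    (fun x => Multiplicative.ofAdd (fun i => ((b.repr (Additive.ofMul x) i : ℤ) : ZMod 3))) (by
      intro x y
      rw [← ofAdd_add]
      congr 1
      funext i
      rw [ofMul_mul, map_add]
      simp)
  have hle : f.ker ≤ (powMonoidHom 3 : M →* M).range := by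
    intro x hx
    have h0 : ∀ i, ((b.repr (Additive.ofMul x) i : ℤ) : ZMod 3) = 0 := by
      intro i
      have := congrArg Multiplicative.toAdd (MonoidHom.mem_ker.mp hx)
      exact congrFun this i
    have h1 : ∀ i, ∃ k : ℤ, b.repr (Additive.ofMul x) i = 3 * k := by
      intro i
      have := (ZMod.intCast_zmod_eq_zero_iff_dvd _ 3).mp (h0 i)
      obtain ⟨k, hk⟩ := this
      exact ⟨k, by simpa using hk⟩
    choose k hk using h1
    refine ⟨(∑ i, k i • b i : Additive M).toMul, ?_⟩
    apply Additive.ofMul.injective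
    rw [powMonoidHom_apply, ofMul_pow, ofMul_toMul]
    conv_rhs => rw [← b.sum_repr (Additive.ofMul x)]
    rw [Finset.smul_sum]
    apply Finset.sum_congr rfl
    intro i _
    rw [hk i, mul_smul]
    exact (natCast_zsmul _ 3).symm
  have hcard : Nat.card (Multiplicative (Fin r → ZMod 3)) = 3 ^ r := by
    rw [Nat.card_eq_fintype_card, Fintype.card_multiplicative, Fintype.card_fun, ZMod.card, Fintype.card_fin]
  have hk0 : f.ker.index ≠ 0 := by
    rw [Subgroup.index_ker]
    exact Nat.card_pos.ne'
  have hk1 : f.ker.index ≤ 3 ^ r := by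
    rw [Subgroup.index_ker, ← hcard]
    exact Subgroup.card_le_card_group _
  have hdvd := Subgroup.index_dvd_of_le hle
  exact ⟨fun h => hk0 (by rw [h] at hdvd; exact zero_dvd_iff.mp hdvd),
    (Nat.le_of_dvd (Nat.pos_of_ne_zero hk0) hdvd).trans hk1⟩

lemma cube_injective {M : Type*} [CommGroup M] {r : ℕ} (b : Module.Basis (Fin r) ℤ (Additive M))
    {x : M} (h : x ^ 3 = 1) : x = 1 := by
  apply Additive.ofMul.injective
  rw [ofMul_one]
  apply b.repr.injective
  rw [map_zero]
  ext i
  have h1 := congrArg (fun y => b.repr (Additive.ofMul y) i) h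
  simp only [ofMul_pow, map_nsmul, ofMul_one, map_zero, Finsupp.smul_apply, Finsupp.zero_apply] at h1
  rw [Finsupp.zero_apply]
  simpa using h1

lemma index_T_le {M : Type*} [CommGroup M] {r : ℕ} (hr : r ≤ 2)
    (b : Module.Basis (Fin r) ℤ (Additive M)) (T σ : M →* M) (hσ : Function.Bijective σ)
    (h : ∀ x, T (T x) * (σ x) ^ 3 = 1) : T.range.index ≠ 0 ∧ T.range.index ≤ 3 := by
  have hinj : Function.Injective T := by
    rw [injective_iff_map_eq_one]
    intro x hx
    have h1 := h x
    rw [hx, map_one, one_mul] at h1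
    have := cube_injective b h1
    exact hσ.1 (by rw [this, map_one])
  have h2 := Subgroup.index_map_of_injective T.range hinj
  have h3 : T.range.map T = (powMonoidHom 3 : M →* M).range := by
    apply le_antisymm
    · rintro _ ⟨_, ⟨x, rfl⟩, rfl⟩
      refine ⟨(σ x)⁻¹, ?_⟩
      rw [powMonoidHom_apply, inv_pow]
      exact (eq_inv_of_mul_eq_one_left (h x)).symm
    · rintro _ ⟨y, rfl⟩
      obtain ⟨x, hx⟩ := hσ.2 y⁻¹
      refine ⟨T x, ⟨x, rfl⟩, ?_⟩
      rw [powMonoidHom_apply, eq_inv_of_mul_eq_one_left (h x), hx, inv_pow, inv_inv]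
  rw [h3] at h2
  obtain ⟨h4, h5⟩ := index_cube_le b
  rw [h2] at h4 h5
  have h6 : T.range.index * T.range.index ≤ 3 * 3 :=
    h5.trans (Nat.pow_le_pow_right (by norm_num) hr)
  exact ⟨fun h0 => h4 (by rw [h0, mul_zero]), Nat.mul_self_le_mul_self_iff.mp h6⟩

lemma add_aux {A : Type*} [AddCommGroup A] (a b c : A) :
    (c - b) - (b - a) + (b + b + b) = a + b + c := by abel

variable {K : Type*} [Field K] [NumberField K]

lemma galois_data (hK : Module.finrank ℚ K = 3) [IsGalois ℚ K] : ∃ s : 𝓞 K ≃+* 𝓞 K,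
    (∀ x, s (s (s x)) = x) ∧ (∀ x, s x = x → ∃ n : ℤ, x = n) := by
  have hcard : Nat.card (K ≃ₐ[ℚ] K) = 3 := by rw [IsGalois.card_aut_eq_finrank, hK]
  have : Fact (Nat.Prime 3) := ⟨Nat.prime_three⟩
  have hcyc : IsCyclic (K ≃ₐ[ℚ] K) := isCyclic_of_prime_card hcard
  obtain ⟨σ, hσ⟩ := hcyc.exists_generator
  have h3 : σ ^ 3 = 1 := by rw [← hcard]; exact pow_card_eq_one'
  refine ⟨RingOfIntegers.mapRingEquiv σ.toRingEquiv, ?_, ?_⟩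
  · intro x
    apply RingOfIntegers.ext
    change σ (σ (σ (x : K))) = x
    exact congrArg (fun τ : K ≃ₐ[ℚ] K => τ (x : K)) h3
  · intro x hx
    have hx' : σ (x : K) = x := congrArg (fun r : 𝓞 K => (r : K)) hx
    have hfix : ∀ τ : K ≃ₐ[ℚ] K, τ (x : K) = x := by
      intro τ
      have hle : Subgroup.zpowers σ ≤ MulAction.stabilizer (K ≃ₐ[ℚ] K) (x : K) := by
        rw [Subgroup.zpowers_le]
        exact hx'
      exact hle (hσ τ)
    have hbot : (x : K) ∈ (⊥ : IntermediateField ℚ K) :=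
      (IsGalois.mem_bot_iff_fixed _).mpr hfix
    obtain ⟨r, hr⟩ := IntermediateField.mem_bot.mp hbot
    have hrInt : IsIntegral ℤ r := by
      have h1 : IsIntegral ℤ (algebraMap ℚ K r) := by
        rw [hr]; exact RingOfIntegers.isIntegral_coe x
      exact (isIntegral_algebraMap_iff (algebraMap ℚ K).injective).mp h1
    obtain ⟨n, hn⟩ := IsIntegrallyClosed.isIntegral_iff.mp hrInt
    refine ⟨n, ?_⟩
    apply RingOfIntegers.ext
    rw [← hr, ← hn]
    simp

lemma norm_int {s : 𝓞 K ≃+* 𝓞 K} (h3 : ∀ x, s (s (s x)) = x)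
    (hfix : ∀ x, s x = x → ∃ n : ℤ, x = n) (x : 𝓞 K) : ∃ n : ℤ, x * s x * s (s x) = n := by
  apply hfix
  rw [map_mul, map_mul, h3]
  ring

/-- Units modulo torsion and the image of `σ - 1`. -/
def twistSub (s : 𝓞 K ≃+* 𝓞 K) : Subgroup (𝓞 K)ˣ :=
  NumberField.Units.torsion K ⊔
    (Units.map (s : 𝓞 K →* 𝓞 K) / MonoidHom.id _ : (𝓞 K)ˣ →* (𝓞 K)ˣ).range

lemma twistSub_index (hK : Module.finrank ℚ K = 3) {s : 𝓞 K ≃+* 𝓞 K}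
    (h3 : ∀ x, s (s (s x)) = x) (hfix : ∀ x, s x = x → ∃ n : ℤ, x = n) :
    (twistSub s).index ≠ 0 ∧ (twistSub s).index ≤ 3 := by
  set σ : (𝓞 K)ˣ →* (𝓞 K)ˣ := Units.map (s : 𝓞 K →* 𝓞 K) with hσ
  set T : (𝓞 K)ˣ →* (𝓞 K)ˣ := σ / MonoidHom.id _ with hT
  set W := NumberField.Units.torsion K with hW
  have hpres : ∀ f : (𝓞 K)ˣ →* (𝓞 K)ˣ, W ≤ W.comap f := by
    intro f x hx
    exact MonoidHom.isOfFinOrder f hx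
  have hσ3 : ∀ x, σ (σ (σ x)) = x := by
    intro x
    ext
    exact congrArg _ (h3 x)
  have hnorm : ∀ x : (𝓞 K)ˣ, x * σ x * σ (σ x) ∈ W := by
    intro x
    obtain ⟨n, hn⟩ := norm_int h3 hfix (x : 𝓞 K)
    obtain ⟨n', hn'⟩ := norm_int h3 hfix ((x⁻¹ : (𝓞 K)ˣ) : 𝓞 K)
    have hx : (x : 𝓞 K) * ((x⁻¹ : (𝓞 K)ˣ) : 𝓞 K) = 1 := by simp
    have hnn : n * n' = 1 := by
      have h1 := congrArg s hx
      have h2 := congrArg s h1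
      rw [map_mul, map_one] at h1
      rw [map_mul, map_mul, map_one, map_one] at h2
      have : (n : 𝓞 K) * n' = 1 := by
        rw [← hn, ← hn']
        calc _ = ((x : 𝓞 K) * ((x⁻¹ : (𝓞 K)ˣ) : 𝓞 K)) * (s x * s ((x⁻¹ : (𝓞 K)ˣ) : 𝓞 K)) *
              (s (s x) * s (s ((x⁻¹ : (𝓞 K)ˣ) : 𝓞 K))) := by ring
          _ = 1 := by rw [hx, h1, h2]; ring
      exact_mod_cast this
    have hsq : (x * σ x * σ (σ x)) ^ 2 = 1 := by
      ext
      have : ((x * σ x * σ (σ x) : (𝓞 K)ˣ) : 𝓞 K) = n := hn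
      rw [Units.val_pow_eq_pow_val, this]
      rcases Int.eq_one_or_neg_one_of_mul_eq_one hnn with rfl | rfl <;> simp
    exact isOfFinOrder_iff_pow_eq_one.mpr ⟨2, by norm_num, hsq⟩
  let T' : (𝓞 K)ˣ ⧸ W →* (𝓞 K)ˣ ⧸ W := QuotientGroup.map W W T (hpres T)
  let σ' : (𝓞 K)ˣ ⧸ W →* (𝓞 K)ˣ ⧸ W := QuotientGroup.map W W σ (hpres σ)
  have hσ'3 : ∀ x, σ' (σ' (σ' x)) = x := by
    intro x
    obtain ⟨x, rfl⟩ := QuotientGroup.mk'_surjective W x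
    change QuotientGroup.mk' W (σ (σ (σ x))) = _
    rw [hσ3]
  have hbij : Function.Bijective σ' :=
    ⟨fun x y h => by rw [← hσ'3 x, h, hσ'3], fun x => ⟨σ' (σ' x), hσ'3 x⟩⟩
  have hTT : ∀ x, T' (T' x) * (σ' x) ^ 3 = 1 := by
    intro x
    obtain ⟨x, rfl⟩ := QuotientGroup.mk'_surjective W x
    change QuotientGroup.mk' W (T (T x) * (σ x) ^ 3) = 1
    rw [QuotientGroup.mk'_apply, QuotientGroup.eq_one_iff]
    have : T (T x) * (σ x) ^ 3 = x * σ x * σ (σ x) := by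
      change σ (σ x / x) / (σ x / x) * (σ x) ^ 3 = x * σ x * σ (σ x)
      rw [_root_.map_div, pow_succ, pow_two]
      exact add_aux (A := Additive (𝓞 K)ˣ) x (σ x) (σ (σ x))
    rw [this]
    exact hnorm x
  have hr : NumberField.Units.rank K ≤ 2 := by
    unfold NumberField.Units.rank
    have h1 := NumberField.InfinitePlace.card_eq_nrRealPlaces_add_nrComplexPlaces K
    have h2 := NumberField.InfinitePlace.card_add_two_mul_card_eq_rank K
    rw [hK] at h2
    omega
  have hfin := index_T_le hr (NumberField.Units.basisModTorsion K) T' σ' hbij hTT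
  have hidx : (twistSub s).index = T'.range.index := by
    have hrange : T'.range = (twistSub s).map (QuotientGroup.mk' W) := by
      rw [twistSub, Subgroup.map_sup]
      have h1 : (NumberField.Units.torsion K).map (QuotientGroup.mk' W) = ⊥ := by
        rw [Subgroup.map_eq_bot_iff, QuotientGroup.ker_mk']
      rw [h1, bot_sup_eq]
      ext y
      constructor
      · rintro ⟨x, rfl⟩
        obtain ⟨x, rfl⟩ := QuotientGroup.mk'_surjective W x
        exact ⟨T x, ⟨x, rfl⟩, rfl⟩
      · rintro ⟨_, ⟨x, rfl⟩, rfl⟩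
        exact ⟨QuotientGroup.mk' W x, rfl⟩
    rw [hrange]
    symm
    apply Subgroup.index_map_eq
    · exact QuotientGroup.mk'_surjective W
    · rw [QuotientGroup.ker_mk']
      exact le_sup_left
  rw [hidx]
  exact hfin
end


section

lemma prime_pow_cancel {R : Type*} [CommMonoidWithZero R] [IsCancelMulZero R] {π A B : R}
    (hπ : Prime π) {a b : ℕ} (h : π ^ a * A = π ^ b * B) (hA : ¬ π ∣ A) (hB : ¬ π ∣ B) : a = b := by
  rcases lt_trichotomy a b with hab | hab | hab
  · exfalso
    obtain ⟨k, rfl⟩ := Nat.exists_eq_add_of_lt hab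
    rw [add_assoc, pow_add, mul_assoc] at h
    have := mul_left_cancel₀ (pow_ne_zero a hπ.ne_zero) h
    exact hA (this ▸ (dvd_pow_self π (Nat.succ_ne_zero k)).mul_right B)
  · exact hab
  · exfalso
    obtain ⟨k, rfl⟩ := Nat.exists_eq_add_of_lt hab
    rw [add_assoc, pow_add, mul_assoc] at h
    have := mul_left_cancel₀ (pow_ne_zero b hπ.ne_zero) h
    exact hB (this ▸ (dvd_pow_self π (Nat.succ_ne_zero k)).mul_right A)

variable {K : Type*} [Field K] [NumberField K]

lemma ram_int_factor (hK : Module.finrank ℚ K = 3) {p : ℕ} (hp : p.Prime) {P : Ideal (𝓞 K)}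
    (h : Ideal.span {(p : 𝓞 K)} = P ^ 3) {n : ℤ} (hn : n ≠ 0) :
    ∃ (k : ℕ) (A : Ideal (𝓞 K)), Ideal.span {(n : 𝓞 K)} = P ^ (3 * k) * A ∧ ¬ P ∣ A := by
  have hfin : FiniteMultiplicity (p : ℤ) n := by
    rw [Int.finiteMultiplicity_iff]
    exact ⟨by simpa using hp.ne_one, hn⟩
  obtain ⟨n', hn', hnd⟩ := hfin.exists_eq_pow_mul_and_not_dvd
  refine ⟨multiplicity (p : ℤ) n, Ideal.span {(n' : 𝓞 K)}, ?_, ?_⟩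
  · rw [pow_mul, ← h, Ideal.span_singleton_pow, Ideal.span_singleton_mul_span_singleton]
    congr 2
    conv_lhs => rw [hn']
    push_cast
    rfl
  · rw [Ideal.dvd_span_singleton, ram_mem_int hK hp h]
    exact hnd

lemma ram_map (hK : Module.finrank ℚ K = 3) {p : ℕ} (hp : p.Prime) {P : Ideal (𝓞 K)}
    (hP : P.IsPrime) (h : Ideal.span {(p : 𝓞 K)} = P ^ 3) (s : 𝓞 K ≃+* 𝓞 K) :
    Ideal.map s P = P := by
  have hP0 : P ≠ ⊥ := by
    rintro rfl
    have := ram_absNorm hK h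
    rw [Ideal.absNorm_bot] at this
    exact hp.ne_zero this.symm
  have h1 : Ideal.map s P ^ 3 = P ^ 3 := by
    rw [← Ideal.map_pow, ← h, Ideal.map_span, Set.image_singleton, map_natCast]
  have hprime : (Ideal.map s P).IsPrime := Ideal.map_isPrime_of_equiv s
  have hle : P ≤ Ideal.map s P :=
    hprime.le_of_pow_le (n := 3) (by rw [← h1]; exact Ideal.pow_le_self (by norm_num))
  exact ((hP.isMaximal hP0).eq_of_le hprime.ne_top hle).symm

lemma ratio_int {s : 𝓞 K ≃+* 𝓞 K} (h3 : ∀ x, s (s (s x)) = x)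
    (hfix : ∀ x, s x = x → ∃ n : ℤ, x = n) {y β η : 𝓞 K} (hy : y ≠ 0) (hβ : β ≠ 0)
    (hη : η = 1 ∨ η = -1) (h : s y * β = η * y * s β) :
    ∃ m n : ℤ, m ≠ 0 ∧ n ≠ 0 ∧ (m : 𝓞 K) * y = n * β := by
  have hs0 : ∀ x : 𝓞 K, x ≠ 0 → s x ≠ 0 := fun x hx => by simpa using hx
  have hsη : s η = η := by rcases hη with rfl | rfl <;> simp
  have e1 := congrArg s h
  simp only [map_mul, hsη] at e1
  have e2 := congrArg s e1
  simp only [map_mul, hsη, h3] at e2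
  have hη1 : η = 1 := by
    rcases hη with rfl | rfl
    · rfl
    · exfalso
      have hne : (y * s y * s (s y)) * (β * s β * s (s β)) ≠ 0 := by
        have := hs0 y hy
        have := hs0 _ this
        have := hs0 β hβ
        have := hs0 _ this
        simp_all
      have : (y * s y * s (s y)) * (β * s β * s (s β)) +
          (y * s y * s (s y)) * (β * s β * s (s β)) = 0 := by
        have e3 : (s y * β) * (s (s y) * s β) * (y * s (s β)) =
          (-1 * y * s β) * (-1 * s y * s (s β)) * (-1 * s (s y) * β) := by rw [h, e1, e2]
        linear_combination e3
      rw [← two_mul] at this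
      rcases mul_eq_zero.mp this with h0 | h0
      · exact two_ne_zero h0
      · exact hne h0
  subst hη1
  rw [one_mul] at h e1 e2
  obtain ⟨m, hm⟩ := norm_int h3 hfix β
  obtain ⟨n, hn⟩ := hfix (y * s β * s (s β)) (by
    simp only [map_mul, h3]
    linear_combination (s (s β)) * h)
  have hsβ := hs0 β hβ
  have hssβ := hs0 _ hsβ
  refine ⟨m, n, ?_, ?_, ?_⟩
  · rintro rfl
    simp only [Int.cast_zero] at hm
    exact mul_ne_zero (mul_ne_zero hβ hsβ) hssβ hm
  · rintro rfl
    simp only [Int.cast_zero] at hn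
    exact mul_ne_zero (mul_ne_zero hy hsβ) hssβ hn
  · rw [← hm, ← hn]; ring

theorem pow_dvd_galois (hK : Module.finrank ℚ K = 3) [IsGalois ℚ K]
    (S : Set ℕ) [Fintype S] (hS : ∀ p ∈ S, p.Prime ∧ TotallyRamified p K) :
    3 ^ (Fintype.card S - 1) ∣ NumberField.classNumber K := by
  classical
  obtain ⟨s, h3, hfix⟩ := galois_data hK
  have hprime : ∀ p : S, (p : ℕ).Prime := fun p => (hS p p.2).1
  choose P hP hP3 using fun p : S => (hS p p.2).2
  have hP0 : ∀ p, P p ≠ ⊥ := by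
    intro p h
    have := ram_absNorm hK (hP3 p)
    rw [h, Ideal.absNorm_bot] at this
    exact (hprime p).ne_zero this.symm
  have hPp : ∀ p, Prime (P p) := fun p => (Ideal.prime_iff_isPrime (hP0 p)).mpr (hP p)
  have hPne : ∀ p p', p ≠ p' → ¬ P p ∣ P p' := by
    intro p p' hne hdvd
    have heq : P p = P p' :=
      (((hP p').isMaximal (hP0 p')).eq_of_le (hP p).ne_top (Ideal.le_of_dvd hdvd)).symm
    have h1 := ram_absNorm hK (hP3 p)
    rw [heq, ram_absNorm hK (hP3 p')] at h1
    exact hne (Subtype.ext h1.symm)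
  let I : (S → ZMod 3) → Ideal (𝓞 K) := fun v => ∏ p, P p ^ (v p).val
  have hI0 : ∀ v, I v ≠ 0 := fun v =>
    Finset.prod_ne_zero_iff.mpr fun p _ => pow_ne_zero _ (hP0 p)
  have hIs : ∀ v, Ideal.map s (I v) = I v := by
    intro v
    have key : ∀ t : Finset S, Ideal.map s (∏ p ∈ t, P p ^ (v p).val) =
        ∏ p ∈ t, P p ^ (v p).val := by
      intro t
      induction t using Finset.induction_on with
      | empty => simp [Ideal.one_eq_top, Ideal.map_top]
      | insert a t ha ih =>
        rw [Finset.prod_insert ha, Ideal.map_mul, Ideal.map_pow, ih,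
          ram_map hK (hprime _) (hP _) (hP3 _) s]
    exact key Finset.univ
  have hIfac : ∀ v p, ∃ J, I v = P p ^ (v p).val * J ∧ ¬ P p ∣ J := by
    intro v p
    refine ⟨∏ p' ∈ Finset.univ.erase p, P p' ^ (v p').val, ?_, ?_⟩
    · exact (Finset.mul_prod_erase _ (fun p' => P p' ^ (v p').val) (Finset.mem_univ p)).symm
    · intro hdvd
      obtain ⟨p', hp', hd⟩ := (hPp p).exists_mem_finset_dvd hdvd
      exact hPne p p' (Finset.ne_of_mem_erase hp').symm ((hPp p).dvd_of_dvd_pow hd)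
  -- the homomorphism to the class group
  let c : S → ClassGroup (𝓞 K) := fun p =>
    ClassGroup.mk0 ⟨P p, mem_nonZeroDivisors_of_ne_zero (hP0 p)⟩
  have hc3 : ∀ p, c p ^ 3 = 1 := by
    intro p
    rw [← map_pow, ClassGroup.mk0_eq_one_iff]
    refine ⟨(p : ℕ), ?_⟩
    rw [Ideal.submodule_span_eq]
    exact (hP3 p).symm
  let Ψ : Multiplicative (S → ZMod 3) →* ClassGroup (𝓞 K) := MonoidHom.mk'
    (fun v => ∏ p, c p ^ (v.toAdd p).val) (by
      intro v w
      rw [← Finset.prod_mul_distrib]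
      apply Finset.prod_congr rfl
      intro p _
      rw [← pow_add, toAdd_mul, Pi.add_apply, ZMod.val_add]
      exact (pow_eq_pow_mod _ (hc3 p)).symm)
  have hΨ : ∀ v, Ψ v = ClassGroup.mk0 ⟨I v.toAdd, mem_nonZeroDivisors_of_ne_zero (hI0 _)⟩ := by
    intro v
    have : (⟨I v.toAdd, mem_nonZeroDivisors_of_ne_zero (hI0 _)⟩ : nonZeroDivisors (Ideal (𝓞 K))) =
        ∏ p, (⟨P p, mem_nonZeroDivisors_of_ne_zero (hP0 p)⟩ : nonZeroDivisors (Ideal (𝓞 K))) ^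
          (v.toAdd p).val := by
      apply Subtype.ext
      rw [Submonoid.coe_finsetProd]
      rfl
    rw [this, map_prod]
    simp only [map_pow]
    rfl
  -- generators
  have hgen : ∀ v : Ψ.ker, ∃ α : 𝓞 K, α ≠ 0 ∧ I v.1.toAdd = Ideal.span {α} ∧
      ∃ u : (𝓞 K)ˣ, s α = α * u := by
    intro v
    have h1 := MonoidHom.mem_ker.mp v.2
    rw [hΨ, ClassGroup.mk0_eq_one_iff] at h1
    obtain ⟨α, hα⟩ := h1
    rw [Ideal.submodule_span_eq] at hα
    have hα' : I v.1.toAdd = Ideal.span {α} := hα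
    refine ⟨α, ?_, hα', ?_⟩
    · rintro rfl
      apply hI0 v.1.toAdd
      rw [hα']
      simp
    · have h2 := hIs v.1.toAdd
      rw [hα', Ideal.map_span, Set.image_singleton, Ideal.span_singleton_eq_span_singleton] at h2
      obtain ⟨u, hu⟩ := h2.symm
      exact ⟨u, hu.symm⟩
  choose α hα0 hαI u hu using hgen
  have hinj : Function.Injective (fun v : Ψ.ker => (QuotientGroup.mk (u v) : (𝓞 K)ˣ ⧸ twistSub s)) := by
    intro v w hvw
    have hmem : (u w)⁻¹ * u v ∈ twistSub s := QuotientGroup.eq.mp hvw.symm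
    obtain ⟨ζ, hζ, t, ⟨ε, rfl⟩, hprod⟩ := Subgroup.mem_sup.mp hmem
    have hζ1 := NumberField.Units.torsion_eq_one_or_neg_one_of_odd_finrank
      (K := K) (by rw [hK]; decide) ⟨ζ, hζ⟩
    have hη : ((ζ : (𝓞 K)ˣ) : 𝓞 K) = 1 ∨ ((ζ : (𝓞 K)ˣ) : 𝓞 K) = -1 := by
      rcases hζ1 with h | h
      · left
        have h : ζ = 1 := h
        rw [h]; simp
      · right
        have h : ζ = -1 := h
        rw [h]; simp
    have hrel : u v * ε = ζ * u w * Units.map (s : 𝓞 K →* 𝓞 K) ε := by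
      have h1 : ζ * (Units.map (s : 𝓞 K →* 𝓞 K) ε / ε) = (u w)⁻¹ * u v := hprod
      have h2 : u v = u w * (ζ * (Units.map (s : 𝓞 K →* 𝓞 K) ε / ε)) := by
        rw [h1, mul_inv_cancel_left]
      rw [h2, mul_assoc, mul_assoc, div_mul_cancel]
      rw [← mul_assoc, mul_comm (u w) ζ]
    have hrel' : (u v : 𝓞 K) * ε = ζ * u w * s ε := congrArg Units.val hrel
    obtain ⟨m, n, hm, hn, hmn⟩ := ratio_int h3 hfix (y := α v) (β := α w * ε) (η := (ζ : 𝓞 K))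
      (hα0 v) (mul_ne_zero (hα0 w) ε.ne_zero) hη (by
        rw [map_mul, hu, hu]
        linear_combination (α v * α w) * hrel')
    have hideal : Ideal.span {(m : 𝓞 K)} * I v.1.toAdd = Ideal.span {(n : 𝓞 K)} * I w.1.toAdd := by
      rw [hαI v, hαI w, Ideal.span_singleton_mul_span_singleton, hmn,
        ← Ideal.span_singleton_mul_span_singleton]
      congr 1
      rw [Ideal.span_singleton_eq_span_singleton]
      exact ⟨ε⁻¹, by simp [mul_assoc]⟩
    apply Subtype.ext
    apply Multiplicative.toAdd.injective
    funext p
    obtain ⟨k, A, hA, hAP⟩ := ram_int_factor hK (hprime p) (hP3 p) hm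
    obtain ⟨l, B, hB, hBP⟩ := ram_int_factor hK (hprime p) (hP3 p) hn
    obtain ⟨J, hJ, hJP⟩ := hIfac v.1.toAdd p
    obtain ⟨J', hJ', hJP'⟩ := hIfac w.1.toAdd p
    rw [hA, hB, hJ, hJ'] at hideal
    have hfin := prime_pow_cancel (hPp p) (a := 3 * k + (v.1.toAdd p).val)
      (b := 3 * l + (w.1.toAdd p).val) (A := A * J) (B := B * J')
      (by rw [pow_add, pow_add, mul_mul_mul_comm, hideal, mul_mul_mul_comm])
      (fun h => ((hPp p).dvd_or_dvd h).elim hAP hJP)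
      (fun h => ((hPp p).dvd_or_dvd h).elim hBP hJP')
    have hv := ZMod.val_lt (v.1.toAdd p)
    have hw := ZMod.val_lt (w.1.toAdd p)
    exact ZMod.val_injective 3 (by omega)
  obtain ⟨hidx0, hidx⟩ := twistSub_index hK h3 hfix
  have hQfin : Finite ((𝓞 K)ˣ ⧸ twistSub s) := Nat.finite_of_card_ne_zero hidx0
  have hker : Nat.card Ψ.ker ≤ 3 := (Nat.card_le_card_of_injective _ hinj).trans hidx
  have hmul : Nat.card Ψ.ker * Nat.card Ψ.range = 3 ^ Fintype.card S := by
    rw [← Subgroup.index_ker, Subgroup.card_mul_index, Nat.card_eq_fintype_card,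
      Fintype.card_multiplicative, Fintype.card_fun, ZMod.card]
  have hdvd : Nat.card Ψ.range ∣ NumberField.classNumber K := by
    have := Subgroup.card_subgroup_dvd_card Ψ.range
    rw [Nat.card_eq_fintype_card (α := ClassGroup (𝓞 K))] at this
    exact this
  refine dvd_trans ?_ hdvd
  obtain ⟨k, hk, hkc⟩ := (Nat.dvd_prime_pow Nat.prime_three).mp (Dvd.intro _ hmul)
  have hk1 : k ≤ 1 := by
    rw [hkc] at hker
    exact (Nat.pow_le_pow_iff_right (a := 3) (by norm_num)).mp (by simpa using hker)
  have hrange : Nat.card Ψ.range = 3 ^ (Fintype.card S - k) := by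
    have h0 : 0 < 3 ^ k := pow_pos (by norm_num) k
    apply Nat.eq_of_mul_eq_mul_left h0
    rw [← pow_add, Nat.add_sub_cancel' hk, ← hmul, hkc]
  rw [hrange]
  exact pow_dvd_pow 3 (by omega)
end


/-- Fröhlich's theorem combined with genus theory: if `e` is the number of odd primes
totally ramified in `K` with `(d/p) = 1`, then `3^(e-1) ∣ h(K)`, and `3^e ∣ h(K)`
when `K/ℚ` is not Galois. -/
theorem pow_three_dvd_classNumber
    (K : Type*) [Field K] [NumberField K] (hK : Module.finrank ℚ K = 3)
    (d : ℤ) (hd : IsResolventDiscrOf (NumberField.discr K) d)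
    (e : ℕ) (he : e = Nat.card {p : ℕ | ∃ hp : p.Prime, Odd p ∧ TotallyRamified p K ∧
      @legendreSym p ⟨hp⟩ d = 1}) :
    (1 ≤ e → 3 ^ (e - 1) ∣ NumberField.classNumber K) ∧
    (1 ≤ e → ¬ IsGalois ℚ K → 3 ^ e ∣ NumberField.classNumber K) := by
  classical
  have fin : 1 ≤ e → Finite {p : ℕ | ∃ hp : p.Prime, Odd p ∧ TotallyRamified p K ∧
      @legendreSym p ⟨hp⟩ d = 1} := by
    intro h
    apply Nat.finite_of_card_ne_zero
    omega
  have key : 1 ≤ e → ¬ IsGalois ℚ K → 3 ^ e ∣ NumberField.classNumber K := by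
    intro h1 hg
    haveI := fin h1
    letI := Fintype.ofFinite {p : ℕ | ∃ hp : p.Prime, Odd p ∧ TotallyRamified p K ∧
      @legendreSym p ⟨hp⟩ d = 1}
    have h0 := NumberField.discr_ne_zero K
    have hsq : ¬ IsSquare (NumberField.discr K) := fun h => hg (isGalois_of_isSquare hK h)
    obtain ⟨u, v, hu, hv, hrel⟩ := resolvent_rel h0 hd
    rw [he, Nat.card_eq_fintype_card]
    exact pow_dvd_nonsquare hK (resolvent_nonsquare h0 hd hsq) hu hv hrel _ (fun p hp => hp)
  refine ⟨fun h1 => ?_, key⟩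
  by_cases hg : IsGalois ℚ K
  · haveI := fin h1
    letI := Fintype.ofFinite {p : ℕ | ∃ hp : p.Prime, Odd p ∧ TotallyRamified p K ∧
      @legendreSym p ⟨hp⟩ d = 1}
    rw [he, Nat.card_eq_fintype_card]
    exact pow_dvd_galois hK _ (fun p ⟨hp, _, h, _⟩ => ⟨hp, h⟩)
  · exact dvd_trans (pow_dvd_pow 3 (Nat.sub_le e 1)) (key h1 hg)

end
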